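/- arXiv:1902.01817 — 10 statements merged into one kernel-verified Lean document; each statement's English description precedes it below -/
import Mathlib

section
/- Let H be an n_R×n_T complex matrix with rank(H) = n_T (full column rank). Then the function Q ↦ log det(I_{n_R} + H Q Hᴴ) is strictly concave on the set of n_T×n_T Hermitian positive semidefinite matrices: for all Hermitian positive semidefinite Q₀ ≠ Q₁ and all t ∈ (0,1), log det(I_{n_R} + H((1−t)Q₀ + tQ₁)Hᴴ) > (1−t) log det(I_{n_R} + HQ₀Hᴴ) + t log det(I_{n_R} + HQ₁Hᴴ). -/
open Matrix
open scoped ComplexOrder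

/-- A covariance matrix `Q` is feasible for per-antenna limits `P` and total limit `Ptot`
if it is Hermitian positive semidefinite, its diagonal entries are bounded by `P`,
and its trace is bounded by `Ptot`. -/
def Feasible {nT : ℕ} (P : Fin nT → ℝ) (Ptot : ℝ) (Q : Matrix (Fin nT) (Fin nT) ℂ) : Prop :=
  Q.PosSemidef ∧ (∀ i, (Q i i).re ≤ P i) ∧ Q.trace.re ≤ Ptot

/-- Mutual information `I(Q) = log det(I + H Q Hᴴ)`; the determinant is a positive real
number, so we take its real part. -/
noncomputable def mutualInfo {nR nT : ℕ} (H : Matrix (Fin nR) (Fin nT) ℂ)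
    (Q : Matrix (Fin nT) (Fin nT) ℂ) : ℝ :=
  Real.log ((1 + H * Q * Hᴴ).det.re)

namespace Matrix

variable {m n : Type*} [Fintype m] [Fintype n]

/-- A square matrix of full rank over a field is invertible. -/
lemma isUnit_of_rank_eq_card {K : Type*} [Field K] [DecidableEq n] {M : Matrix n n K}
    (h : M.rank = Fintype.card n) : IsUnit M := by
  rw [← mulVec_surjective_iff_isUnit]
  have htop : LinearMap.range M.mulVecLin = ⊤ :=
    Submodule.eq_top_of_finrank_eq (by rw [Module.finrank_fintype_fun_eq_card, ← h, rank])
  exact LinearMap.range_eq_top.mp htop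

/-- If `H` has full column rank then `Q ↦ H Q Hᴴ` is injective. -/
lemma mul_mul_conjTranspose_injective_of_rank_eq_card {H : Matrix m n ℂ}
    (h : H.rank = Fintype.card n) : Function.Injective fun Q : Matrix n n ℂ ↦ H * Q * Hᴴ := by
  classical
  intro X Y hXY
  have hU : IsUnit (Hᴴ * H) :=
    isUnit_of_rank_eq_card ((rank_conjTranspose_mul_self H).trans h)
  have key : Hᴴ * H * X * (Hᴴ * H) = Hᴴ * H * Y * (Hᴴ * H) := by
    simpa only [Matrix.mul_assoc] using congrArg (fun Z ↦ Hᴴ * Z * H) hXY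
  exact hU.mul_left_cancel (hU.mul_right_cancel key)

variable [DecidableEq n]

/-- A Hermitian matrix all of whose eigenvalues are `1` is the identity. -/
lemma IsHermitian.eq_one_of_eigenvalues_eq_one {A : Matrix n n ℂ} (hA : A.IsHermitian)
    (h : ∀ i, hA.eigenvalues i = 1) : A = 1 := by
  have hd : (RCLike.ofReal ∘ hA.eigenvalues : n → ℂ) = 1 := by
    ext i
    simp [h i]
  have hs := hA.spectral_theorem
  rw [hd] at hs
  simpa using hs

namespace PosDef

lemma det_re_pos {A : Matrix n n ℂ} (hA : A.PosDef) : 0 < A.det.re :=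
  (Complex.lt_def.mp hA.det_pos).1

lemma ofReal_det_re {A : Matrix n n ℂ} (hA : A.PosDef) : (A.det.re : ℂ) = A.det :=
  Complex.ext rfl (Complex.lt_def.mp hA.det_pos).2

lemma log_det_lt_trace_sub_card {A : Matrix n n ℂ} (hA : A.PosDef) (hne : A ≠ 1) :
    Real.log A.det.re < A.trace.re - Fintype.card n := by
  have hdet : A.det.re = ∏ i, hA.1.eigenvalues i := by
    rw [hA.1.det_eq_prod_eigenvalues]
    exact_mod_cast Complex.ofReal_re _
  have htr : A.trace.re = ∑ i, hA.1.eigenvalues i := by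
    rw [hA.1.trace_eq_sum_eigenvalues]
    exact_mod_cast Complex.ofReal_re _
  obtain ⟨i, hi⟩ : ∃ i, hA.1.eigenvalues i ≠ 1 := by
    by_contra! h
    exact hne (hA.1.eq_one_of_eigenvalues_eq_one h)
  have hsum : ∑ i, Real.log (hA.1.eigenvalues i) < ∑ i, (hA.1.eigenvalues i - 1) :=
    Finset.sum_lt_sum (fun j _ ↦ Real.log_le_sub_one_of_pos (hA.eigenvalues_pos j))
      ⟨i, Finset.mem_univ i, Real.log_lt_sub_one_of_pos (hA.eigenvalues_pos i) hi⟩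
  rw [hdet, htr, Real.log_prod fun j _ ↦ (hA.eigenvalues_pos j).ne']
  simpa using hsum

open scoped MatrixOrder in
/-- The tangent-plane bound for `log det` at a positive definite `M`, strict away from `M`. -/
lemma log_det_sub_log_det_lt {M A : Matrix n n ℂ} (hM : M.PosDef) (hA : A.PosDef)
    (hne : A ≠ M) :
    Real.log A.det.re - Real.log M.det.re < (M⁻¹ * A).trace.re - Fintype.card n := by
  obtain ⟨B, hB⟩ := CStarAlgebra.nonneg_iff_eq_star_mul_self.mp hM.inv.posSemidef.nonneg
  rw [star_eq_conjTranspose] at hB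
  have hMdet : IsUnit M.det := (isUnit_iff_isUnit_det M).mp hM.isUnit
  have hBu : IsUnit B := by
    have h : IsUnit (Bᴴ * B) := hB ▸ hM.inv.isUnit
    rw [isUnit_iff_isUnit_det, det_mul] at h
    exact (isUnit_iff_isUnit_det B).mpr (isUnit_of_mul_isUnit_right h)
  have hBu' : IsUnit Bᴴ := hBu.star
  have hC : (B * A * Bᴴ).PosDef := by
    simpa [star_eq_conjTranspose] using (IsUnit.posDef_star_right_conjugate_iff hBu).mpr hA
  have hCne : B * A * Bᴴ ≠ 1 := by
    intro h
    have h' : Bᴴ * B * A * Bᴴ = Bᴴ := by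
      simpa only [Matrix.mul_assoc, Matrix.mul_one] using congrArg (Bᴴ * ·) h
    have h'' : M⁻¹ * A = 1 := hBu'.mul_right_cancel (by rw [hB, h', Matrix.one_mul])
    exact hne (by
      rw [← Matrix.mul_one M, ← h'', mul_nonsing_inv_cancel_left _ _ hMdet])
  have htr : (B * A * Bᴴ).trace = (M⁻¹ * A).trace := by
    rw [trace_mul_comm, ← Matrix.mul_assoc, ← hB]
  have hdet : (B * A * Bᴴ).det * M.det = A.det := by
    have hinv : (Bᴴ * B).det * M.det = 1 := by
      rw [← hB, ← det_mul, nonsing_inv_mul _ hMdet, det_one]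
    rw [det_mul] at hinv
    rw [det_mul, det_mul]
    linear_combination A.det * hinv
  have hdet' : A.det.re = (B * A * Bᴴ).det.re * M.det.re := by
    apply Complex.ofReal_injective
    rw [Complex.ofReal_mul, hA.ofReal_det_re, hC.ofReal_det_re, hM.ofReal_det_re, hdet]
  have hlt := hC.log_det_lt_trace_sub_card hCne
  rw [htr] at hlt
  rw [hdet', Real.log_mul hC.det_re_pos.ne' hM.det_re_pos.ne']
  linarith

end PosDef

/-- `log det` is strictly concave on positive definite matrices. -/
theorem strictConcaveOn_log_det :
    StrictConcaveOn ℝ {A : Matrix n n ℂ | A.PosDef} fun A ↦ Real.log A.det.re := by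
  have hmix {A B : Matrix n n ℂ} (hA : A.PosDef) (hB : B.PosDef) {a b : ℝ} (ha : 0 ≤ a)
      (hb : 0 ≤ b) (hab : a + b = 1) : (a • A + b • B).PosDef := by
    rcases ha.eq_or_lt with rfl | ha
    · obtain rfl : b = 1 := by linarith
      simpa using hB
    · exact (hA.smul ha).add_posSemidef (hB.posSemidef.smul hb)
  refine ⟨fun A hA B hB a b ha hb hab ↦ hmix hA hB ha hb hab, ?_⟩
  intro A hA B hB hne a b ha hb hab
  have hM := hmix hA hB ha.le hb.le hab
  have hb' : b = 1 - a := by linarith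
  have hAM : A ≠ a • A + b • B := by
    intro h
    have h0 : b • (A - B) = 0 := by
      rw [smul_sub, sub_eq_zero]
      calc b • A = A - a • A := by rw [hb', sub_smul, one_smul]
        _ = b • B := by rw [sub_eq_iff_eq_add']; exact h
    exact hne (sub_eq_zero.mp ((smul_eq_zero.mp h0).resolve_left hb.ne'))
  have hBM : B ≠ a • A + b • B := by
    intro h
    have h0 : a • (B - A) = 0 := by
      rw [smul_sub, sub_eq_zero]
      calc a • B = B - b • B := by rw [hb', sub_smul, one_smul, sub_sub_cancel]
        _ = a • A := by rw [sub_eq_iff_eq_add]; exact h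
    exact hne (sub_eq_zero.mp ((smul_eq_zero.mp h0).resolve_left ha.ne')).symm
  have h1 := hM.log_det_sub_log_det_lt hA hAM
  have h2 := hM.log_det_sub_log_det_lt hB hBM
  set M := a • A + b • B with hMdef
  have htr : a * (M⁻¹ * A).trace.re + b * (M⁻¹ * B).trace.re = Fintype.card n := by
    have h : (M⁻¹ * (a • A + b • B)).trace.re = Fintype.card n := by
      rw [← hMdef, nonsing_inv_mul _ ((isUnit_iff_isUnit_det M).mp hM.isUnit), trace_one,
        Complex.natCast_re]
    simpa [Matrix.mul_add, trace_add, trace_smul] using h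
  simp only [smul_eq_mul]
  have h1' := mul_lt_mul_of_pos_left h1 ha
  have h2' := mul_lt_mul_of_pos_left h2 hb
  subst hb'
  linarith

end Matrix

/-- Strict concavity of the mutual information when `H` has full column rank. -/
theorem stmt_1 (nR nT : ℕ) (H : Matrix (Fin nR) (Fin nT) ℂ) (hrank : H.rank = nT)
    (Q₀ Q₁ : Matrix (Fin nT) (Fin nT) ℂ) (h₀ : Q₀.PosSemidef) (h₁ : Q₁.PosSemidef)
    (hne : Q₀ ≠ Q₁) (t : ℝ) (ht : t ∈ Set.Ioo (0 : ℝ) 1) :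
    (1 - t) * mutualInfo H Q₀ + t * mutualInfo H Q₁ <
      mutualInfo H ((1 - t) • Q₀ + t • Q₁) := by
  have hinj := mul_mul_conjTranspose_injective_of_rank_eq_card
    (hrank.trans (Fintype.card_fin nT).symm)
  have hpos {Q : Matrix (Fin nT) (Fin nT) ℂ} (hQ : Q.PosSemidef) : (1 + H * Q * Hᴴ).PosDef :=
    PosDef.one.add_posSemidef (hQ.mul_mul_conjTranspose_same H)
  have hlt := strictConcaveOn_log_det.2 (hpos h₀) (hpos h₁)
    (fun h ↦ hne (hinj (add_left_cancel h))) (sub_pos.mpr ht.2) ht.1 (sub_add_cancel 1 t)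
  have hmix : (1 - t) • (1 + H * Q₀ * Hᴴ) + t • (1 + H * Q₁ * Hᴴ) =
      1 + H * ((1 - t) • Q₀ + t • Q₁) * Hᴴ := by
    simp only [Matrix.mul_add, Matrix.add_mul, Matrix.mul_smul, Matrix.smul_mul]
    module
  rw [hmix] at hlt
  exact hlt
end

section
/- Let H be an n_R×n_T complex matrix with rank(H) = n_T (full column rank). If Q and Q' are n_T×n_T Hermitian positive semidefinite matrices with Q' − Q positive semidefinite and Q' ≠ Q, then log det(I_{n_R} + H Q' Hᴴ) > log det(I_{n_R} + H Q Hᴴ). -/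
open Matrix
open scoped ComplexOrder

/-- A nonzero positive semidefinite matrix `M` satisfies `1 < det (1 + M)`. -/
theorem Matrix.PosSemidef.one_lt_det_one_add {n 𝕜 : Type*} [Fintype n] [DecidableEq n] [RCLike 𝕜]
    {M : Matrix n n 𝕜} (hM : M.PosSemidef) (h0 : M ≠ 0) : 1 < (1 + M).det := by
  have hdet : (1 + M).det = ((∏ i, (1 + hM.1.eigenvalues i) : ℝ) : 𝕜) := by
    conv_lhs => rw [hM.1.spectral_theorem, Unitary.conjStarAlgAut_apply, det_one_add_mul_comm,
      ← mul_assoc, Unitary.coe_star_mul_self, one_mul, ← diagonal_one, diagonal_add, det_diagonal]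
    simp
  obtain ⟨i, hi⟩ := Function.ne_iff.mp (mt hM.1.eigenvalues_eq_zero_iff.mp h0)
  have hprod : ∏ _j : n, (1 : ℝ) < ∏ j, (1 + hM.1.eigenvalues j) :=
    Finset.prod_lt_prod (fun _ _ => one_pos)
      (fun j _ => le_add_of_nonneg_right (hM.eigenvalues_nonneg j))
      ⟨i, Finset.mem_univ i,
        lt_add_of_pos_right 1 (lt_of_le_of_ne (hM.eigenvalues_nonneg i) hi.symm)⟩
  rw [Finset.prod_const_one] at hprod
  rw [hdet]
  exact_mod_cast hprod

open scoped MatrixOrder in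
/-- The determinant is strictly monotone in the Loewner order on positive definite matrices. -/
theorem Matrix.PosDef.det_lt_det_add {n 𝕜 : Type*} [Fintype n] [DecidableEq n] [RCLike 𝕜]
    {A B : Matrix n n 𝕜} (hA : A.PosDef) (hB : B.PosSemidef) (h0 : B ≠ 0) :
    A.det < (A + B).det := by
  obtain ⟨C, rfl⟩ := CStarAlgebra.nonneg_iff_eq_star_mul_self.mp hB.nonneg
  obtain ⟨T, hT⟩ := CStarAlgebra.nonneg_iff_eq_star_mul_self.mp hA.inv.posSemidef.nonneg
  rw [star_eq_conjTranspose] at *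
  have hunit : IsUnit A.det := hA.det_pos.ne'.isUnit
  have hM : C * A⁻¹ * Cᴴ = (T * Cᴴ)ᴴ * (T * Cᴴ) := by
    simp [hT, Matrix.mul_assoc]
  have hfactor : (A + Cᴴ * C).det = A.det * (1 + C * A⁻¹ * Cᴴ).det := by
    rw [Matrix.mul_assoc, det_one_add_mul_comm, ← det_mul, Matrix.mul_add, Matrix.mul_assoc,
      mul_nonsing_inv_cancel_left _ _ hunit, Matrix.mul_one]
  have hne : C * A⁻¹ * Cᴴ ≠ 0 := by
    intro h
    rw [hM, conjTranspose_mul_self_eq_zero] at h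
    have hC : Cᴴ = 0 := by
      rw [← mul_nonsing_inv_cancel_left A Cᴴ hunit, hT, Matrix.mul_assoc, h]
      simp
    exact h0 (by simp [hC])
  rw [hfactor]
  exact lt_mul_of_one_lt_right hA.det_pos
    ((hM ▸ posSemidef_conjTranspose_mul_self (T * Cᴴ)).one_lt_det_one_add hne)

/-- Congruence by a matrix of full column rank is injective. -/
theorem Matrix.eq_zero_of_mul_mul_conjTranspose_eq_zero {m n 𝕜 : Type*} [Fintype m] [Fintype n]
    [DecidableEq n] [RCLike 𝕜] {H : Matrix m n 𝕜} (hH : H.rank = Fintype.card n)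
    {D : Matrix n n 𝕜} (h : H * D * Hᴴ = 0) : D = 0 := by
  have hG : IsUnit (Hᴴ * H) := by
    rw [← mulVec_surjective_iff_isUnit]
    have htop : LinearMap.range (Hᴴ * H).mulVecLin = ⊤ := by
      refine Submodule.eq_top_of_finrank_eq ?_
      rw [← Matrix.rank, rank_conjTranspose_mul_self, hH, Module.finrank_fintype_fun_eq_card]
    exact LinearMap.range_eq_top.mp htop
  have hGDG : Hᴴ * H * D * (Hᴴ * H) = 0 := by
    rw [show Hᴴ * H * D * (Hᴴ * H) = Hᴴ * (H * D * Hᴴ) * H by simp only [Matrix.mul_assoc], h]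
    simp
  exact hG.mul_right_eq_zero.mp (hG.mul_left_eq_zero.mp hGDG)

/-- Strict monotonicity of the mutual information in the Loewner order when `H` has
full column rank. -/
theorem stmt_2 (nR nT : ℕ) (H : Matrix (Fin nR) (Fin nT) ℂ) (hrank : H.rank = nT)
    (Q Q' : Matrix (Fin nT) (Fin nT) ℂ) (hQ : Q.PosSemidef) (hQ' : Q'.PosSemidef)
    (hle : (Q' - Q).PosSemidef) (hne : Q' ≠ Q) :
    mutualInfo H Q < mutualInfo H Q' := by
  have hA : (1 + H * Q * Hᴴ).PosDef := PosDef.one.add_posSemidef (hQ.mul_mul_conjTranspose_same H)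
  have hD : H * (Q' - Q) * Hᴴ ≠ 0 := fun h =>
    hne (sub_eq_zero.mp (eq_zero_of_mul_mul_conjTranspose_eq_zero (by simpa using hrank) h))
  have hlt := hA.det_lt_det_add (hle.mul_mul_conjTranspose_same H) hD
  rw [add_assoc, ← Matrix.add_mul, ← Matrix.mul_add, add_sub_cancel] at hlt
  exact Real.log_lt_log (Complex.pos_iff.mp hA.det_pos).1 (Complex.lt_def.mp hlt).1
end

section
/- Let H be an n_R×n_T complex matrix with rank(H) = n_T, let P_1,…,P_{n_T} ≥ 0 and P_tot ≥ 0 with Σ_{i=1}^{n_T} P_i ≥ P_tot. If Q* is feasible and maximizes the mutual information I(Q) = log det(I_{n_R} + H Q Hᴴ) over all feasible Q, then the total power constraint is active at the optimum: trace(Q*) = P_tot. -/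
open Matrix
open scoped ComplexOrder

/-- A nonzero rank-one positive semidefinite update strictly increases the determinant of a
positive definite matrix. -/
lemma Matrix.PosDef.det_lt_det_add_vecMulVec_star {n : Type*} [Fintype n] [DecidableEq n]
    {A : Matrix n n ℂ} (hA : A.PosDef) {u : n → ℂ} (hu : u ≠ 0) :
    A.det < (A + vecMulVec u (star u)).det := by
  have hdet : (A + vecMulVec u (star u)).det = A.det * (1 + star u ⬝ᵥ A⁻¹ *ᵥ u) := by
    rw [vecMulVec_eq Unit, det_add_replicateCol_mul_replicateRow hA.det_pos.ne'.isUnit,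
      Matrix.mul_assoc, det_unique (n := Unit), ← replicateCol_mulVec A⁻¹ u,
      Matrix.add_apply, one_apply_eq, replicateRow_mul_replicateCol_apply]
  rw [hdet, mul_add, mul_one]
  exact lt_add_of_pos_right _ (mul_pos hA.det_pos (hA.inv.dotProduct_mulVec_pos hu))

lemma mutualInfo_lt_mutualInfo_add_vecMulVec_star {nR nT : ℕ} {H : Matrix (Fin nR) (Fin nT) ℂ}
    {Q : Matrix (Fin nT) (Fin nT) ℂ} (hQ : Q.PosSemidef) {x : Fin nT → ℂ} (hx : H *ᵥ x ≠ 0) :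
    mutualInfo H Q < mutualInfo H (Q + vecMulVec x (star x)) := by
  have hA : (1 + H * Q * Hᴴ).PosDef := PosDef.one.add_posSemidef (hQ.mul_mul_conjTranspose_same H)
  have hupdate : 1 + H * (Q + vecMulVec x (star x)) * Hᴴ =
      1 + H * Q * Hᴴ + vecMulVec (H *ᵥ x) (star (H *ᵥ x)) := by
    rw [Matrix.mul_add, Matrix.add_mul, mul_vecMulVec, vecMulVec_mul, star_mulVec, add_assoc]
  rw [mutualInfo, mutualInfo, hupdate]
  exact Real.log_lt_log (Complex.pos_iff.mp hA.det_pos).1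
    (Complex.lt_def.mp (hA.det_lt_det_add_vecMulVec_star hx)).1

lemma Matrix.col_ne_zero_of_rank_eq_card {m n K : Type*} [Fintype n] [Field K]
    {A : Matrix m n K} (hA : A.rank = Fintype.card n) (i : n) : A.col i ≠ 0 := by
  refine (linearIndependent_iff_card_eq_finrank_span.mpr ?_ : LinearIndependent K A.col).ne_zero i
  rw [Set.finrank, ← rank_eq_finrank_span_cols, hA]

/-- In the full-rank case the total power constraint is active at the optimum. -/
theorem stmt_3 (nR nT : ℕ) (H : Matrix (Fin nR) (Fin nT) ℂ) (hrank : H.rank = nT)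
    (P : Fin nT → ℝ) (hP : ∀ i, 0 ≤ P i) (Ptot : ℝ) (hPtot : 0 ≤ Ptot)
    (hsum : Ptot ≤ ∑ i, P i)
    (Qopt : Matrix (Fin nT) (Fin nT) ℂ) (hfeas : Feasible P Ptot Qopt)
    (hopt : ∀ Q, Feasible P Ptot Q → mutualInfo H Q ≤ mutualInfo H Qopt) :
    Qopt.trace.re = Ptot := by
  obtain ⟨hpsd, hdiag, htr⟩ := hfeas
  by_contra hne
  have hlt : Qopt.trace.re < Ptot := lt_of_le_of_ne htr hne
  obtain ⟨i, hi⟩ : ∃ i, (Qopt i i).re < P i := by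
    by_contra! hge
    have hle : ∑ i, P i ≤ Qopt.trace.re := by
      rw [trace, Complex.re_sum]
      exact Finset.sum_le_sum fun i _ ↦ hge i
    linarith
  obtain ⟨ε, hε, hεmin⟩ := exists_between
    (lt_min (sub_pos.mpr hi) (sub_pos.mpr hlt))
  obtain ⟨hεP, hεtot⟩ := lt_min_iff.mp hεmin
  set x : Fin nT → ℂ := Pi.single i (√ε : ℂ) with hx
  have hxx : (√ε : ℂ) * √ε = ε := by
    rw [← Complex.ofReal_mul, Real.mul_self_sqrt hε.le]
  have hHx : H *ᵥ x ≠ 0 := by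
    rw [hx, mulVec_single]
    simpa [(Real.sqrt_pos.mpr hε).ne'] using
      H.col_ne_zero_of_rank_eq_card (by simpa using hrank) i
  have hentry : ∀ j, vecMulVec x (star x) j j = if j = i then (ε : ℂ) else 0 := by
    intro j
    by_cases hj : j = i
    · subst hj
      simp [vecMulVec_apply, hx, hxx]
    · simp [vecMulVec_apply, hx, hj]
  refine (hopt (Qopt + vecMulVec x (star x)) ⟨?_, fun j ↦ ?_, ?_⟩).not_gt
    (mutualInfo_lt_mutualInfo_add_vecMulVec_star hpsd hHx)
  · exact hpsd.add (posSemidef_vecMulVec_self_star x)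
  · rw [Matrix.add_apply, hentry]
    split_ifs with hj
    · subst hj
      rw [Complex.add_re, Complex.ofReal_re]
      linarith
    · simpa using hdiag j
  · have htrace : (vecMulVec x (star x)).trace = (ε : ℂ) := by simp [trace, hentry]
    rw [trace_add, htrace, Complex.add_re, Complex.ofReal_re]
    linarith
end

section
/- (Theorem 2, singular case, structural form.) Let H be an n_R×n_T complex matrix with rank(H) = ν < n_T whose columns are all nonzero, let P_1,…,P_{n_T} > 0 and P_tot > 0. If Q* is feasible and maximizes the mutual information I(Q) = log det(I_{n_R} + H Q Hᴴ) over all feasible Q, then there exists an n_T×n_T real diagonal matrix Ď with strictly positive diagonal entries such that H Q* Hᴴ = (H Ď Hᴴ − I_{n_R})₊. -/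
open Matrix
open scoped ComplexOrder

/-- Positive part of a Hermitian matrix: `(A)₊ = U diag(max λᵢ 0) Uᴴ` where
`A = U diag(λ) Uᴴ` is a spectral decomposition (0 for non-Hermitian input). -/
noncomputable def posPartMat {n : ℕ} (A : Matrix (Fin n) (Fin n) ℂ) : Matrix (Fin n) (Fin n) ℂ :=
  if hA : A.IsHermitian then
    (hA.eigenvectorUnitary : Matrix (Fin n) (Fin n) ℂ) *
      Matrix.diagonal (fun i => ((max (hA.eigenvalues i) 0 : ℝ) : ℂ)) *
      star (hA.eigenvectorUnitary : Matrix (Fin n) (Fin n) ℂ)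
  else 0

namespace Matrix.PosSemidef

variable {n : Type*} [Fintype n] {A B : Matrix n n ℂ}

open scoped MatrixOrder in
lemma exists_eq_conjTranspose_mul_self (hA : A.PosSemidef) : ∃ R : Matrix n n ℂ, A = Rᴴ * R := by
  classical
  exact CStarAlgebra.nonneg_iff_eq_star_mul_self.1 hA.nonneg

lemma trace_mul_nonneg (hA : A.PosSemidef) (hB : B.PosSemidef) : 0 ≤ (A * B).trace := by
  obtain ⟨R, rfl⟩ := hA.exists_eq_conjTranspose_mul_self
  have h := (hB.mul_mul_conjTranspose_same R).trace_nonneg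
  rwa [trace_mul_comm, ← Matrix.mul_assoc] at h

lemma mul_eq_zero_of_trace_mul_eq_zero (hA : A.PosSemidef) (hB : B.PosSemidef)
    (h : (A * B).trace = 0) : A * B = 0 := by
  obtain ⟨R, rfl⟩ := hA.exists_eq_conjTranspose_mul_self
  obtain ⟨K, rfl⟩ := hB.exists_eq_conjTranspose_mul_self
  have h0 : R * Kᴴ = 0 := by
    rw [← trace_mul_conjTranspose_self_eq_zero_iff, ← h, conjTranspose_mul,
      conjTranspose_conjTranspose, Matrix.mul_assoc Rᴴ, trace_mul_comm Rᴴ]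
    simp only [Matrix.mul_assoc]
  rw [Matrix.mul_assoc, ← Matrix.mul_assoc R, h0, Matrix.zero_mul, Matrix.mul_zero]

/-- A Hermitian matrix pairing nonnegatively with the positive semidefinite cone is itself positive
semidefinite. -/
lemma of_trace_mul_re_nonneg (hA : A.IsHermitian)
    (h : ∀ X : Matrix n n ℂ, X.PosSemidef → 0 ≤ (A * X).trace.re) : A.PosSemidef := by
  refine .of_dotProduct_mulVec_nonneg hA fun v => ?_
  have hv := h _ (posSemidef_vecMulVec_self_star v)
  rw [mul_vecMulVec, trace_vecMulVec, dotProduct_comm] at hv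
  exact Complex.nonneg_iff.2 ⟨hv, (hA.im_star_dotProduct_mulVec_self v).symm⟩

/-- A decomposition into a difference of positive semidefinite matrices with vanishing product
is unique. -/
lemma eq_of_sub_eq_sub {S N : Matrix n n ℂ} (hA : A.PosSemidef) (hB : B.PosSemidef)
    (hS : S.PosSemidef) (hN : N.PosSemidef) (hAB : B * A = 0) (hNS : N * S = 0)
    (h : A - B = S - N) : A = S := by
  have hd : (A - S)ᴴ = A - S := (hA.1.sub hS.1).eq
  have hsub : A - S = B - N := by
    rw [sub_eq_sub_iff_add_eq_add] at h ⊢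
    rw [h, add_comm]
  have htr : ((A - S)ᴴ * (A - S)).trace = -((N * A).trace + (B * S).trace) := by
    rw [hd]
    nth_rw 1 [hsub]
    simp only [Matrix.sub_mul, Matrix.mul_sub, hAB, hNS, trace_sub, trace_zero]
    ring
  have hle : ((A - S)ᴴ * (A - S)).trace ≤ 0 := by
    rw [htr]
    exact neg_nonpos.2 (add_nonneg (hN.trace_mul_nonneg hA) (hB.trace_mul_nonneg hS))
  exact sub_eq_zero.1 <| trace_conjTranspose_mul_self_eq_zero_iff.1 <|
    le_antisymm hle (posSemidef_conjTranspose_mul_self _).trace_nonneg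

end Matrix.PosSemidef

lemma posPartMat_sub {n : ℕ} {S N : Matrix (Fin n) (Fin n) ℂ} (hS : S.PosSemidef)
    (hN : N.PosSemidef) (hNS : N * S = 0) : posPartMat (S - N) = S := by
  have hA : (S - N).IsHermitian := hS.1.sub hN.1
  rw [posPartMat, dif_pos hA]
  set U : Matrix (Fin n) (Fin n) ℂ := (hA.eigenvectorUnitary : Matrix (Fin n) (Fin n) ℂ)
  have hU : star U * U = 1 := Unitary.coe_star_mul_self hA.eigenvectorUnitary
  have hconj (e : Fin n → ℝ) (he : ∀ i, 0 ≤ e i) :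
      (U * diagonal (fun i => ((e i : ℝ) : ℂ)) * star U).PosSemidef :=
    (PosSemidef.diagonal fun i => Complex.zero_le_real.2 (he i)).mul_mul_conjTranspose_same U
  refine PosSemidef.eq_of_sub_eq_sub
    (B := U * diagonal (fun i => ((max (-hA.eigenvalues i) 0 : ℝ) : ℂ)) * star U)
    (hconj _ fun i => le_max_right _ _) (hconj _ fun i => le_max_right _ _) hS hN ?_ hNS ?_
  · calc _ = U * (diagonal (fun i => ((max (-hA.eigenvalues i) 0 : ℝ) : ℂ)) * (star U * U) *
          diagonal (fun i => ((max (hA.eigenvalues i) 0 : ℝ) : ℂ))) * star U := by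
            simp only [Matrix.mul_assoc]
      _ = 0 := by
        rw [hU, Matrix.mul_one, diagonal_mul_diagonal]
        have : (fun i => ((max (-hA.eigenvalues i) 0 : ℝ) : ℂ) *
            ((max (hA.eigenvalues i) 0 : ℝ) : ℂ)) = 0 := by
          ext i
          rcases le_total 0 (hA.eigenvalues i) with h | h <;> simp [h]
        rw [this]
        simp
  · rw [← Matrix.sub_mul, ← Matrix.mul_sub, diagonal_sub]
    conv_rhs => rw [hA.spectral_theorem]
    rw [Unitary.conjStarAlgAut_apply]
    congr 3
    ext i
    rcases le_total 0 (hA.eigenvalues i) with h | h <;> simp [h]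

/-- Lagrange multipliers for the maximization of a linear functional over the feasible set. -/
lemma Feasible.exists_multiplier {n : ℕ} {P : Fin n → ℝ} (hP : ∀ i, 0 < P i) {Ptot : ℝ}
    (hPtot : 0 < Ptot) {G Q : Matrix (Fin n) (Fin n) ℂ} (hQ : Feasible P Ptot Q)
    (hmax : ∀ X, Feasible P Ptot X → (G * X).trace.re ≤ (G * Q).trace.re) :
    ∃ d : Fin n → ℝ, ∀ X : Matrix (Fin n) (Fin n) ℂ, X.PosSemidef →
      (G * X).trace.re - ∑ i, d i * (X i i).re ≤ (G * Q).trace.re - ∑ i, d i * (Q i i).re := by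
  set q := (G * Q).trace.re
  let s : Set ((Fin n → ℝ) × ℝ) := {p | ∃ X : Matrix (Fin n) (Fin n) ℂ, X.PosSemidef ∧
    (∀ i, (X i i).re < p.1 i) ∧ p.2 < (G * X).trace.re}
  let t : Set ((Fin n → ℝ) × ℝ) := {p | (∀ i, p.1 i ≤ P i) ∧ ∑ i, p.1 i ≤ Ptot ∧ q ≤ p.2}
  have hs : Convex ℝ s := by
    rintro p ⟨X, hX, hXp, hXg⟩ p' ⟨Y, hY, hYp, hYg⟩ a b ha hb hab
    refine ⟨a • X + b • Y, (hX.smul ha).add (hY.smul hb), fun i => ?_, ?_⟩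
    · have h1 := hXp i
      have h2 := hYp i
      simp only [Matrix.add_apply, Matrix.smul_apply, Complex.add_re, Complex.real_smul, Complex.re_ofReal_mul,
        Prod.fst_add, Prod.smul_fst, Pi.add_apply, Pi.smul_apply, smul_eq_mul]
      rcases ha.eq_or_lt with rfl | ha
      · obtain rfl : b = 1 := by linarith
        simpa using h2
      · nlinarith [mul_lt_mul_of_pos_left h1 ha]
    · simp only [Matrix.mul_add, Matrix.mul_smul, trace_add, trace_smul, Complex.add_re,
        Complex.real_smul, Complex.re_ofReal_mul, Prod.snd_add, Prod.smul_snd, smul_eq_mul]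
      rcases ha.eq_or_lt with rfl | ha
      · obtain rfl : b = 1 := by linarith
        simpa using hYg
      · nlinarith [mul_lt_mul_of_pos_left hXg ha]
  have hso : IsOpen s := by
    have : s = ⋃ (X : Matrix (Fin n) (Fin n) ℂ) (_ : X.PosSemidef),
        ((⋂ i, {p : (Fin n → ℝ) × ℝ | (X i i).re < p.1 i}) ∩ {p | p.2 < (G * X).trace.re}) := by
      ext p
      simp [s, and_left_comm]
    rw [this]
    refine isOpen_iUnion fun X => isOpen_iUnion fun _ =>
      (isOpen_iInter_of_finite fun i => ?_).inter ?_
    · exact isOpen_lt (by fun_prop) (by fun_prop)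
    · exact isOpen_lt (by fun_prop) (by fun_prop)
  have ht : Convex ℝ t := by
    rintro p ⟨h1, h2, h3⟩ p' ⟨h1', h2', h3'⟩ a b ha hb hab
    obtain rfl : b = 1 - a := by linarith
    refine ⟨fun i => ?_, ?_, ?_⟩
    · simp only [Prod.fst_add, Prod.smul_fst, Pi.add_apply, Pi.smul_apply, smul_eq_mul]
      nlinarith [h1 i, h1' i]
    · simp only [Prod.fst_add, Prod.smul_fst, Pi.add_apply, Pi.smul_apply, smul_eq_mul,
        Finset.sum_add_distrib, ← Finset.mul_sum]
      nlinarith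
    · simp only [Prod.snd_add, Prod.smul_snd, smul_eq_mul]
      nlinarith
  have hdisj : Disjoint s t := by
    rw [Set.disjoint_left]
    rintro p ⟨X, hX, hXp, hXg⟩ ⟨h1, h2, h3⟩
    refine (h3.trans_lt hXg).not_ge (hmax X ⟨hX, fun i => (hXp i).le.trans (h1 i), ?_⟩)
    refine le_trans ?_ h2
    simp only [trace, diag_apply, Complex.re_sum]
    exact Finset.sum_le_sum fun i _ => (hXp i).le
  obtain ⟨f, u, hfs, hft⟩ := geometric_hahn_banach_open hs hso ht hdisj
  set τ := f (0, 1)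
  set a : Fin n → ℝ := fun i => f (Pi.single i 1, 0)
  have hf (v : Fin n → ℝ) (r : ℝ) : f (v, r) = ∑ i, a i * v i + τ * r := by
    have hv : (v, r) = ∑ i, v i • ((Pi.single i 1, 0) : (Fin n → ℝ) × ℝ) + r • (0, 1) := by
      ext i
      · simp [Prod.fst_sum, Finset.sum_apply, Pi.single_apply]
      · simp [Prod.snd_sum]
    rw [hv, map_add, map_sum, map_smul]
    simp only [map_smul, smul_eq_mul, a, τ, mul_comm]
  have hτ : 0 < τ := by
    have hPs : 0 ≤ ∑ i, P i := Finset.sum_nonneg fun i _ => (hP i).le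
    obtain ⟨c, hc0, hc1, hc2⟩ : ∃ c : ℝ, 0 < c ∧ c ≤ 1 ∧ c * ∑ i, P i ≤ Ptot := by
      refine ⟨min 1 (Ptot / (∑ i, P i + 1)), by positivity, min_le_left _ _, ?_⟩
      refine (mul_le_mul_of_nonneg_right (min_le_right _ _) hPs).trans ?_
      rw [div_mul_eq_mul_div, div_le_iff₀ (by positivity)]
      nlinarith
    have h1 := hfs (fun i => c * P i, min (-1) (q - 1))
      ⟨0, .zero, fun i => by simpa using mul_pos hc0 (hP i), by simp⟩
    have h2 := hft (fun i => c * P i, q)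
      ⟨fun i => by nlinarith [hP i], by simpa only [← Finset.mul_sum] using hc2, le_rfl⟩
    rw [hf] at h1 h2
    nlinarith [min_le_right (-1) (q - 1)]
  have hle (X : Matrix (Fin n) (Fin n) ℂ) (hX : X.PosSemidef) :
      ∑ i, a i * (X i i).re + τ * (G * X).trace.re ≤ u := by
    refine le_of_forall_pos_le_add fun ε hε => ?_
    set c := ∑ i, a i - τ
    have hc : 0 < |c| + 1 := by positivity
    set r := ε / (|c| + 1)
    have hr0 : 0 < r := by positivity
    have h := hfs (fun i => (X i i).re + r, (G * X).trace.re - r)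
      ⟨X, hX, fun i => by simpa using hr0, by simpa using hr0⟩
    rw [hf] at h
    simp only [mul_add, Finset.sum_add_distrib, ← Finset.sum_mul] at h
    have hrc : r * (|c| + 1) = ε := div_mul_cancel₀ _ hc.ne'
    nlinarith [neg_abs_le c]
  have hu : u ≤ ∑ i, a i * (Q i i).re + τ * q := by
    rw [← hf]
    refine hft _ ⟨hQ.2.1, ?_, le_rfl⟩
    simpa only [trace, diag_apply, Complex.re_sum] using hQ.2.2
  refine ⟨fun i => -a i / τ, fun X hX => ?_⟩
  have hsum (v : Fin n → ℝ) : τ * ∑ i, -a i / τ * v i = -∑ i, a i * v i := by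
    rw [Finset.mul_sum, ← Finset.sum_neg_distrib]
    exact Finset.sum_congr rfl fun i _ => by field_simp
  refine le_of_mul_le_mul_left ?_ hτ
  rw [mul_sub, mul_sub, hsum fun i => (X i i).re, hsum fun i => (Q i i).re]
  linarith [hle X hX]

lemma Feasible.convex_comb {n : ℕ} {P : Fin n → ℝ} {Ptot : ℝ} {Q X : Matrix (Fin n) (Fin n) ℂ}
    (hQ : Feasible P Ptot Q) (hX : Feasible P Ptot X) {s : ℝ} (h0 : 0 ≤ s) (h1 : s ≤ 1) :
    Feasible P Ptot ((1 - s) • Q + s • X) := by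
  have h1' : 0 ≤ 1 - s := by linarith
  refine ⟨(hQ.1.smul h1').add (hX.1.smul h0), fun i => ?_, ?_⟩
  · simp only [Matrix.add_apply, Matrix.smul_apply, Complex.add_re, Complex.real_smul, Complex.re_ofReal_mul]
    nlinarith [hQ.2.1 i, hX.2.1 i]
  · simp only [trace_add, trace_smul, Complex.add_re, Complex.real_smul, Complex.re_ofReal_mul]
    nlinarith [hQ.2.2, hX.2.2]

lemma posDef_one_add_mul_mul_conjTranspose {m n : ℕ} (H : Matrix (Fin m) (Fin n) ℂ)
    {Q : Matrix (Fin n) (Fin n) ℂ} (hQ : Q.PosSemidef) : (1 + H * Q * Hᴴ).PosDef :=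
  PosDef.one.add_posSemidef (hQ.mul_mul_conjTranspose_same H)

/-- First-order optimality condition for the mutual information. -/
lemma Feasible.trace_mul_le_of_forall_mutualInfo_le {m n : ℕ} {H : Matrix (Fin m) (Fin n) ℂ}
    {P : Fin n → ℝ} {Ptot : ℝ} {Q X : Matrix (Fin n) (Fin n) ℂ} (hQ : Feasible P Ptot Q)
    (hopt : ∀ Y, Feasible P Ptot Y → mutualInfo H Y ≤ mutualInfo H Q) (hX : Feasible P Ptot X) :
    (Hᴴ * (1 + H * Q * Hᴴ)⁻¹ * H * X).trace.re ≤ (Hᴴ * (1 + H * Q * Hᴴ)⁻¹ * H * Q).trace.re := by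
  have hW := posDef_one_add_mul_mul_conjTranspose H hQ.1
  set W := 1 + H * Q * Hᴴ with hWdef
  have hWu : IsUnit W.det := (isUnit_iff_isUnit_det _).1 hW.isUnit
  set M := W⁻¹ * (H * (X - Q) * Hᴴ) with hM
  have htr : (Hᴴ * W⁻¹ * H * X).trace.re - (Hᴴ * W⁻¹ * H * Q).trace.re = M.trace.re := by
    rw [← Complex.sub_re, ← trace_sub, ← Matrix.mul_sub, hM]
    congr 1
    simp only [Matrix.mul_assoc]
    rw [trace_mul_comm Hᴴ]
    simp only [Matrix.mul_assoc]
  set p := (det (1 + (Polynomial.X : Polynomial ℂ) • M.map Polynomial.C)).divX.divX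
  have hbound (s : ℝ) (hs : s ∈ Set.Ioo (0 : ℝ) 1) : M.trace.re + s * (p.eval (s : ℂ)).re ≤ 0 := by
    have hfs := hQ.convex_comb hX hs.1.le hs.2.le
    have hWs := posDef_one_add_mul_mul_conjTranspose H hfs.1
    have heq : 1 + H * ((1 - s) • Q + s • X) * Hᴴ = W * (1 + (s : ℂ) • M) := by
      rw [Matrix.mul_add W, Matrix.mul_one, Matrix.mul_smul, hM, mul_nonsing_inv_cancel_left _ _ hWu,
        hWdef, add_assoc, Complex.coe_smul]
      congr 1
      simp only [Matrix.mul_add, Matrix.add_mul, Matrix.mul_sub, Matrix.sub_mul, Matrix.mul_smul,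
        Matrix.smul_mul]
      module
    have hlog := hopt _ hfs
    have hdW := Complex.pos_iff.1 hW.det_pos
    have hdWs := Complex.pos_iff.1 hWs.det_pos
    rw [mutualInfo, mutualInfo, Real.log_le_log_iff hdWs.1 hdW.1, heq, det_mul, Complex.mul_re,
      ← hdW.2, zero_mul, sub_zero, det_one_add_smul] at hlog
    have hle : (1 + M.trace * (s : ℂ) + p.eval (s : ℂ) * (s : ℂ) ^ 2).re ≤ 1 :=
      le_of_mul_le_mul_left (by rwa [mul_one]) hdW.1
    rw [← Complex.ofReal_pow, Complex.add_re, Complex.add_re, Complex.re_mul_ofReal,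
      Complex.re_mul_ofReal, Complex.one_re] at hle
    refine nonpos_of_mul_nonpos_right (b := M.trace.re + s * (p.eval (s : ℂ)).re) ?_ hs.1
    linarith
  have hlim : Filter.Tendsto (fun s : ℝ => M.trace.re + s * (p.eval (s : ℂ)).re)
      (nhdsWithin 0 (Set.Ioi 0)) (nhds (M.trace.re + 0 * (p.eval ((0 : ℝ) : ℂ)).re)) := by
    refine Filter.Tendsto.mono_left (Continuous.tendsto ?_ 0) nhdsWithin_le_nhds
    fun_prop
  have := le_of_tendsto hlim <|
    Filter.eventually_of_mem (Ioo_mem_nhdsGT zero_lt_one) hbound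
  linarith

/-- Karush–Kuhn–Tucker conditions for the linearized problem. -/
lemma Feasible.exists_diagonal_sub_posSemidef {n : ℕ} {P : Fin n → ℝ} (hP : ∀ i, 0 < P i)
    {Ptot : ℝ} (hPtot : 0 < Ptot) {G Q : Matrix (Fin n) (Fin n) ℂ} (hG : G.IsHermitian)
    (hQ : Feasible P Ptot Q)
    (hmax : ∀ X, Feasible P Ptot X → (G * X).trace.re ≤ (G * Q).trace.re) :
    ∃ d : Fin n → ℝ, (diagonal (fun i => (d i : ℂ)) - G).PosSemidef ∧
      (diagonal (fun i => (d i : ℂ)) - G) * Q = 0 := by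
  obtain ⟨d, hd⟩ := hQ.exists_multiplier hP hPtot hmax
  set Z := diagonal (fun i => (d i : ℂ)) - G with hZ
  have htr (X : Matrix (Fin n) (Fin n) ℂ) :
      (Z * X).trace.re = ∑ i, d i * (X i i).re - (G * X).trace.re := by
    simp [hZ, Matrix.sub_mul, trace, Complex.re_sum]
  have hmin (X : Matrix (Fin n) (Fin n) ℂ) (hX : X.PosSemidef) :
      (Z * Q).trace.re ≤ (Z * X).trace.re := by
    rw [htr, htr]
    linarith [hd X hX]
  have h0 : (Z * Q).trace.re = 0 := by
    have h1 := hmin 0 .zero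
    have h2 := hmin (Q + Q) (hQ.1.add hQ.1)
    simp only [Matrix.mul_zero, trace_zero, Complex.zero_re, Matrix.mul_add, trace_add,
      Complex.add_re] at h1 h2
    linarith
  have hZp : Z.PosSemidef := by
    refine .of_trace_mul_re_nonneg (IsHermitian.sub ?_ hG) fun X hX => h0 ▸ hmin X hX
    exact isHermitian_diagonal_iff.2 fun i => Complex.conj_ofReal _
  refine ⟨d, hZp, hZp.mul_eq_zero_of_trace_mul_eq_zero hQ.1 ?_⟩
  exact Complex.ext h0 (Complex.nonneg_iff.1 (hZp.trace_mul_nonneg hQ.1)).2.symm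

/-- Theorem 2 (singular case, structural form): if `rank H < nT` and all columns of `H`
are nonzero, the optimal covariance satisfies `H Q* Hᴴ = (H Ď Hᴴ − I)₊` for some
positive diagonal `Ď`. -/
theorem stmt_7 (nR nT : ℕ) (H : Matrix (Fin nR) (Fin nT) ℂ) (hrank : H.rank < nT)
    (hcol : ∀ j, ∃ i, H i j ≠ 0)
    (P : Fin nT → ℝ) (hP : ∀ i, 0 < P i) (Ptot : ℝ) (hPtot : 0 < Ptot)
    (Qopt : Matrix (Fin nT) (Fin nT) ℂ) (hfeas : Feasible P Ptot Qopt)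
    (hopt : ∀ Q, Feasible P Ptot Q → mutualInfo H Q ≤ mutualInfo H Qopt) :
    ∃ d : Fin nT → ℝ, (∀ i, 0 < d i) ∧
      H * Qopt * Hᴴ =
        posPartMat (H * Matrix.diagonal (fun i => (d i : ℂ)) * Hᴴ - 1) := by
  have hW := posDef_one_add_mul_mul_conjTranspose H hfeas.1
  set S := H * Qopt * Hᴴ with hS
  set W := 1 + S with hWdef
  have hSp : S.PosSemidef := hfeas.1.mul_mul_conjTranspose_same H
  have hWu : IsUnit W.det := (isUnit_iff_isUnit_det _).1 hW.isUnit
  have hG : (Hᴴ * W⁻¹ * H).PosSemidef := hW.inv.posSemidef.conjTranspose_mul_mul_same H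
  obtain ⟨d, hZ, hZQ⟩ := hfeas.exists_diagonal_sub_posSemidef hP hPtot hG.1
    fun X hX => hfeas.trace_mul_le_of_forall_mutualInfo_le hopt hX
  have hd (i : Fin nT) : 0 < d i := by
    have hne : H.col i ≠ 0 := fun h => (hcol i).elim fun k hk => hk (congrFun h k)
    have h1 := hW.inv.dotProduct_mulVec_pos hne
    have h2 : star (H.col i) ⬝ᵥ (W⁻¹ *ᵥ H.col i) = (Hᴴ * W⁻¹ * H) i i := by
      rw [Matrix.mul_assoc]
      rfl
    have h3 := hZ.diag_nonneg (i := i)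
    rw [h2] at h1
    rw [Matrix.sub_apply, diagonal_apply_eq, sub_nonneg] at h3
    exact_mod_cast h1.trans_le h3
  have hD : (diagonal fun i => (d i : ℂ)).PosDef :=
    PosDef.diagonal fun i => by exact_mod_cast hd i
  have hDu : IsUnit (diagonal fun i => (d i : ℂ)).det := (isUnit_iff_isUnit_det _).1 hD.isUnit
  have hDinv : (diagonal fun i => (((d i)⁻¹ : ℝ) : ℂ)) = (diagonal fun i => (d i : ℂ))⁻¹ := by
    refine (inv_eq_left_inv ?_).symm
    rw [diagonal_mul_diagonal, ← diagonal_one]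
    congr 1
    ext i
    rw [← Complex.ofReal_mul, inv_mul_cancel₀ (hd i).ne', Complex.ofReal_one]
  refine ⟨fun i => (d i)⁻¹, fun i => inv_pos.2 (hd i), ?_⟩
  rw [hDinv]
  set D := diagonal fun i => (d i : ℂ)
  set K := H * D⁻¹ * Hᴴ with hK
  have hN : (W - K).PosSemidef := by
    let := invertibleOfIsUnitDet W hWu
    let := invertibleOfIsUnitDet D hDu
    exact (hD.fromBlocks₂₂ W H).1 ((hW.fromBlocks₁₁ H D).2 hZ)
  have hNS : (W - K) * S = 0 := by
    have hDQ : D * Qopt = Hᴴ * W⁻¹ * H * Qopt := by rwa [Matrix.sub_mul, sub_eq_zero] at hZQ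
    have hSK : S = K * (W⁻¹ * S) := by
      calc S = H * (D⁻¹ * (D * Qopt)) * Hᴴ := by rw [nonsing_inv_mul_cancel_left _ _ hDu]
        _ = K * (W⁻¹ * S) := by rw [hDQ, hK, hS]; simp only [Matrix.mul_assoc]
    have hcomm : W * S = S * W := by rw [hWdef, Matrix.add_mul, Matrix.mul_add]; simp
    have hinv : W⁻¹ * S * W = S := by
      rw [Matrix.mul_assoc, ← hcomm, nonsing_inv_mul_cancel_left _ _ hWu]
    rw [Matrix.sub_mul, sub_eq_zero, hcomm]
    nth_rw 1 [hSK]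
    rw [Matrix.mul_assoc, hinv]
  have hdec : K - 1 = S - (W - K) := by
    rw [hWdef]
    abel
  rw [hdec, posPartMat_sub hSp hN hNS]
end

section
/- (Corollary 4, rank of the optimal covariance.) Let H be a nonzero n_R×n_T complex matrix whose columns are all nonzero, let P_1,…,P_{n_T} > 0 and P_tot > 0. If Q* is feasible and maximizes the mutual information I(Q) = log det(I_{n_R} + H Q Hᴴ) over all feasible Q, then 1 ≤ rank(Q*) ≤ rank(H). -/
open Matrix
open scoped ComplexOrder

namespace Matrix

theorem PosDef.det_lt_det_add_smul_vecMulVec {n : Type*} [Fintype n] [DecidableEq n]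
    {A : Matrix n n ℂ} (hA : A.PosDef) {u : n → ℂ} (hu : u ≠ 0) {r : ℂ} (hr : 0 < r) :
    A.det < (A + r • vecMulVec u (star u)).det := by
  have hdet : 0 < A.det := hA.det_pos
  have hpos : 0 < star u ⬝ᵥ (A⁻¹ *ᵥ u) := hA.inv.dotProduct_mulVec_pos hu
  have hform : (replicateRow Unit (star u) * A⁻¹ * replicateCol Unit (r • u)) () () =
      r * (star u ⬝ᵥ (A⁻¹ *ᵥ u)) := by
    rw [dotProduct_mulVec, ← replicateRow_vecMul, mul_apply, dotProduct, Finset.mul_sum]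
    simp [mul_left_comm]
  rw [← smul_vecMulVec, vecMulVec_eq Unit,
    det_add_replicateCol_mul_replicateRow hdet.ne'.isUnit, det_unique (n := Unit)]
  simp only [PUnit.default_eq_unit, Matrix.add_apply, one_apply_eq, hform]
  exact lt_mul_of_one_lt_right hdet (lt_add_of_pos_right _ (mul_pos hr hpos))

theorem PosSemidef.exists_sub_smul_vecMulVec_mulVec {n : Type*} [Fintype n] [DecidableEq n]
    {Q : Matrix n n ℂ} (hQ : Q.PosSemidef) (w : n → ℂ) :
    ∃ t : ℂ, 0 < t ∧ (Q - t • vecMulVec (Q *ᵥ w) (star (Q *ᵥ w))).PosSemidef := by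
  set v := Q *ᵥ w with hv
  set s := star w ⬝ᵥ v with hs
  have hs0 : 0 ≤ s := hQ.dotProduct_mulVec_nonneg w
  have hs1 : 0 < s + 1 := add_pos_of_nonneg_of_pos hs0 one_pos
  set a := (s + 1)⁻¹ with ha
  have ha0 : 0 < a := inv_pos.mpr hs1
  have hstar : star a = a := (IsSelfAdjoint.of_nonneg ha0.le).star_eq
  have has : a * s = 1 - a := by
    rw [ha]; field_simp; ring
  refine ⟨a + a * a, add_pos ha0 (mul_pos ha0 ha0), ?_⟩
  have hwQ : star w ᵥ* Q = star v := by
    rw [hv, star_mulVec, hQ.isHermitian.eq]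
  have key := hQ.conjTranspose_mul_mul_same (1 - a • vecMulVec w (star v))
  convert key using 1
  rw [conjTranspose_sub, conjTranspose_smul, conjTranspose_vecMulVec, hstar, star_star,
    conjTranspose_one, Matrix.sub_mul, Matrix.mul_sub]
  simp only [Matrix.one_mul, Matrix.mul_one, Matrix.smul_mul, Matrix.mul_smul, vecMulVec_mul, hwQ,
    mul_vecMulVec, sub_mulVec, smul_mulVec, ← hv, vecMulVec_mulVec]
  have hvw : star v ⬝ᵥ w = s := by rw [← hwQ, ← dotProduct_mulVec]
  ext i j
  simp [hvw, vecMulVec_apply]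
  linear_combination -a * v i * starRingEnd ℂ (v j) * has

theorem rank_le_of_mulVec_mul_eq_zero {l m n K : Type*} [Fintype m] [Fintype n] [Field K]
    [Fintype l] (A : Matrix l m K) (B : Matrix m n K)
    (h : ∀ w, A *ᵥ (B *ᵥ w) = 0 → B *ᵥ w = 0) : B.rank ≤ A.rank := by
  refine le_trans ?_ (rank_mul_le_left A B)
  have hker : LinearMap.ker (A * B).mulVecLin ≤ LinearMap.ker B.mulVecLin := by
    intro w hw
    simp only [LinearMap.mem_ker, mulVecLin_apply, ← mulVec_mulVec] at hw ⊢
    exact h w hw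
  have h1 := (A * B).mulVecLin.finrank_range_add_finrank_ker
  have h2 := B.mulVecLin.finrank_range_add_finrank_ker
  have h3 := Submodule.finrank_mono hker
  unfold rank
  omega

end Matrix

theorem mutualInfo_lt_add_smul {nR nT : ℕ} {H : Matrix (Fin nR) (Fin nT) ℂ}
    {Q : Matrix (Fin nT) (Fin nT) ℂ} (hQ : Q.PosSemidef) {u : Fin nT → ℂ} (hu : H *ᵥ u ≠ 0)
    {r : ℂ} (hr : 0 < r) :
    mutualInfo H Q < mutualInfo H (Q + r • vecMulVec u (star u)) := by
  have hA : (1 + H * Q * Hᴴ).PosDef :=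
    PosDef.one.add_posSemidef (hQ.mul_mul_conjTranspose_same H)
  have heq : 1 + H * (Q + r • vecMulVec u (star u)) * Hᴴ =
      1 + H * Q * Hᴴ + r • vecMulVec (H *ᵥ u) (star (H *ᵥ u)) := by
    rw [Matrix.mul_add, Matrix.add_mul, Matrix.mul_smul, Matrix.smul_mul, mul_vecMulVec,
      vecMulVec_mul, star_mulVec, add_assoc]
  have hlt := hA.det_lt_det_add_smul_vecMulVec hu hr
  unfold mutualInfo
  rw [heq]
  exact Real.log_lt_log (Complex.pos_iff.mp hA.det_pos).1 (Complex.lt_def.mp hlt).1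

/-- Corollary 4 (rank of the optimal covariance): `1 ≤ rank(Q*) ≤ rank(H)`. -/
theorem stmt_8 (nR nT : ℕ) (H : Matrix (Fin nR) (Fin nT) ℂ) (hH : H ≠ 0)
    (hcol : ∀ j, ∃ i, H i j ≠ 0)
    (P : Fin nT → ℝ) (hP : ∀ i, 0 < P i) (Ptot : ℝ) (hPtot : 0 < Ptot)
    (Qopt : Matrix (Fin nT) (Fin nT) ℂ) (hfeas : Feasible P Ptot Qopt)
    (hopt : ∀ Q, Feasible P Ptot Q → mutualInfo H Q ≤ mutualInfo H Qopt) :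
    1 ≤ Qopt.rank ∧ Qopt.rank ≤ H.rank := by
  have hcol' : ∀ j, H *ᵥ Pi.single j 1 ≠ 0 := by
    intro j h
    obtain ⟨i, hi⟩ := hcol j
    apply hi
    simpa using congrFun h i
  have hsingle : ∀ (j : Fin nT) (r : ℂ), 0 < r →
      (r • vecMulVec (Pi.single j (1 : ℂ)) (star (Pi.single j (1 : ℂ)))).PosSemidef :=
    fun j r hr => (posSemidef_vecMulVec_self_star _).smul hr.le
  have hdiag : ∀ (j : Fin nT) (r : ℂ) (i : Fin nT),
      (r • vecMulVec (Pi.single j (1 : ℂ)) (star (Pi.single j (1 : ℂ)))) i i =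
        if i = j then r else 0 := by
    intro j r i
    by_cases h : i = j <;> simp [vecMulVec_apply, h]
  have htrace : ∀ (j : Fin nT) (r : ℂ),
      (r • vecMulVec (Pi.single j (1 : ℂ)) (star (Pi.single j (1 : ℂ)))).trace = r := by
    intro j r
    simp only [trace, diag_apply, hdiag]
    simp
  constructor
  · rw [Nat.one_le_iff_ne_zero]
    intro hrank
    have hzero : Qopt = 0 := by
      rw [Matrix.rank, Submodule.finrank_eq_zero, LinearMap.range_eq_bot] at hrank
      exact toLin'.map_eq_zero_iff.mp hrank
    obtain ⟨j⟩ : Nonempty (Fin nT) := by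
      by_contra hne
      rw [not_nonempty_iff] at hne
      exact hH (Subsingleton.elim _ _)
    have hr : (0 : ℂ) < ((min (P j) Ptot : ℝ) : ℂ) := by
      exact_mod_cast lt_min (hP j) hPtot
    refine absurd (hopt _ ⟨hfeas.1.add (hsingle j _ hr), fun i => ?_, ?_⟩)
      (mutualInfo_lt_add_smul hfeas.1 (hcol' j) hr).not_ge
    · rw [Matrix.add_apply, hdiag, hzero]
      by_cases h : i = j
      · simp [h]
      · simpa [h] using (hP i).le
    · rw [trace_add, htrace, hzero]
      simp
  · refine rank_le_of_mulVec_mul_eq_zero H Qopt fun w hw => ?_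
    by_contra hne
    obtain ⟨j, hj⟩ := Function.ne_iff.mp hne
    obtain ⟨t, ht, hpsd⟩ := hfeas.1.exists_sub_smul_vecMulVec_mulVec w
    set v := Qopt *ᵥ w with hv
    have hterm : ∀ i, 0 ≤ t * (v i * star (v i)) := fun i =>
      mul_nonneg ht.le (mul_star_self_nonneg _)
    have hr : 0 < t * (v j * star (v j)) := by
      refine lt_of_le_of_ne (hterm j) (Ne.symm ?_)
      simpa [ht.ne'] using hj
    have hsame : mutualInfo H (Qopt - t • vecMulVec v (star v)) = mutualInfo H Qopt := by
      unfold mutualInfo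
      rw [Matrix.mul_sub, Matrix.mul_smul, mul_vecMulVec, hw]
      simp
    refine absurd (hopt _ ⟨hpsd.add (hsingle j _ hr), fun i => ?_, ?_⟩)
      (hsame ▸ mutualInfo_lt_add_smul hpsd (hcol' j) hr).not_ge
    · refine le_trans (Complex.le_def.mp ?_).1 (hfeas.2.1 i)
      rw [Matrix.add_apply, hdiag, Matrix.sub_apply, Matrix.smul_apply, vecMulVec_apply, smul_eq_mul, Pi.star_apply]
      split_ifs with h
      · rw [h, sub_add_cancel]
      · rw [add_zero]
        exact sub_le_self _ (hterm i)
    · refine le_trans (Complex.le_def.mp ?_).1 hfeas.2.2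
      rw [trace_add, htrace, trace_sub, trace_smul, trace_vecMulVec, smul_eq_mul, dotProduct,
        Finset.mul_sum, sub_add, sub_le_self_iff, sub_nonneg]
      exact Finset.single_le_sum (f := fun i => t * (v i * star (v i))) (fun i _ => hterm i)
        (Finset.mem_univ j)
end

section
/- (Theorem 3, unit-rank MIMO capacity.) Let H = c·u·vᴴ be an n_R×n_T complex matrix of rank one, where c = ‖H‖ > 0 (Frobenius norm), u ∈ ℂ^{n_R} and v ∈ ℂ^{n_T} are unit-norm vectors, and v_i ≠ 0 for every i. Let P_1,…,P_{n_T} > 0 and 0 < P_tot ≤ Σ_{i=1}^{n_T} P_i, and let α > 0 satisfy Σ_{i=1}^{n_T} min(α|v_i|², P_i) = P_tot. Define q ∈ ℂ^{n_T} by q_i = √(min(α|v_i|², P_i)) · (v_i/|v_i|). Then Q* = q qᴴ is feasible, trace(Q*) = P_tot (the total power constraint is attained with equality), and for every feasible Q, log det(I_{n_R} + H Q Hᴴ) ≤ log det(I_{n_R} + H Q* Hᴴ) = log(1 + c²·(Σ_{i=1}^{n_T} |v_i|·√(min(α|v_i|², P_i)))²). -/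
open Matrix
open scoped ComplexOrder

theorem det_one_add_smul_vecMulVec_mul {nR nT : ℕ} (u : Fin nR → ℂ) (v : Fin nT → ℂ)
    (hu : ∑ i, ‖u i‖ ^ 2 = 1) (c : ℝ) (Q : Matrix (Fin nT) (Fin nT) ℂ) :
    (1 + ((c : ℂ) • vecMulVec u (star v)) * Q * ((c : ℂ) • vecMulVec u (star v))ᴴ).det =
      1 + (c : ℂ) ^ 2 * (star v ⬝ᵥ Q *ᵥ v) := by
  have hu' : star u ⬝ᵥ u = 1 := by
    have h : star u ⬝ᵥ u = ((∑ i, ‖u i‖ ^ 2 : ℝ) : ℂ) := by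
      simp [dotProduct, Complex.conj_mul']
    rw [h, hu, Complex.ofReal_one]
  have hH : ((c : ℂ) • vecMulVec u (star v)) * Q * ((c : ℂ) • vecMulVec u (star v))ᴴ =
      vecMulVec (((c : ℂ) ^ 2 * (star v ⬝ᵥ Q *ᵥ v)) • u) (star u) := by
    rw [conjTranspose_smul, conjTranspose_vecMulVec, star_star, Matrix.smul_mul,
      Matrix.smul_mul, vecMulVec_mul, Matrix.mul_smul, vecMulVec_mul_vecMulVec,
      ← dotProduct_mulVec, smul_vecMulVec,
      vecMulVec_smul]
    simp [smul_smul, sq, mul_assoc]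
  rw [hH, vecMulVec_eq Unit, det_one_add_replicateCol_mul_replicateRow, dotProduct_smul, hu',
    smul_eq_mul, mul_one]

theorem mutualInfo_smul_vecMulVec {nR nT : ℕ} (u : Fin nR → ℂ) (v : Fin nT → ℂ)
    (hu : ∑ i, ‖u i‖ ^ 2 = 1) (c : ℝ) (Q : Matrix (Fin nT) (Fin nT) ℂ) :
    mutualInfo ((c : ℂ) • vecMulVec u (star v)) Q =
      Real.log (1 + c ^ 2 * (star v ⬝ᵥ Q *ᵥ v).re) := by
  rw [mutualInfo, det_one_add_smul_vecMulVec_mul u v hu, ← Complex.ofReal_pow, Complex.add_re,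
    Complex.re_ofReal_mul, Complex.one_re]

theorem Matrix.PosSemidef.re_dotProduct_mulVec_le {n : Type*} [Fintype n] [DecidableEq n]
    {Q : Matrix n n ℂ} (hQ : Q.PosSemidef) (v : n → ℂ) :
    (star v ⬝ᵥ Q *ᵥ v).re ≤ (∑ i, ‖v i‖ * Real.sqrt (Q i i).re) ^ 2 := by
  obtain ⟨B, rfl⟩ : ∃ B : Matrix n n ℂ, Q = Bᴴ * B := by
    open scoped MatrixOrder in
    exact CStarAlgebra.nonneg_iff_eq_star_mul_self.mp hQ.nonneg
  let b : n → EuclideanSpace ℂ n := fun i => WithLp.toLp 2 fun k => B k i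
  have hb (i : n) : Real.sqrt ((Bᴴ * B) i i).re = ‖b i‖ := by
    rw [EuclideanSpace.norm_eq]
    simp [b, mul_apply, Complex.conj_mul', ← Complex.ofReal_pow]
  have hs : (star v ⬝ᵥ (Bᴴ * B) *ᵥ v).re = ‖∑ i, v i • b i‖ ^ 2 := by
    rw [← mulVec_mulVec, dotProduct_mulVec, ← star_mulVec, EuclideanSpace.norm_sq_eq,
      dotProduct, Complex.re_sum]
    refine Finset.sum_congr rfl fun k _ => ?_
    rw [Pi.star_apply, ← starRingEnd_apply, Complex.conj_mul', ← Complex.ofReal_pow,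
      Complex.ofReal_re]
    simp [b, mulVec, dotProduct, mul_comm]
  simp only [hs, hb, ← norm_smul]
  gcongr
  exact norm_sum_le _ _

theorem two_mul_sqrt_mul_sub_sqrt_min_le {a α x p : ℝ} (ha : 0 ≤ a) (hα : 0 ≤ α) (hx : 0 ≤ x)
    (hp : 0 ≤ p) (hxp : x ≤ p) :
    2 * Real.sqrt α * (a * Real.sqrt x - a * Real.sqrt (min (α * a ^ 2) p)) ≤
      x - min (α * a ^ 2) p := by
  obtain h | h := le_total (α * a ^ 2) p
  · rw [min_eq_left h, Real.sqrt_mul hα, Real.sqrt_sq ha]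
    nlinarith [sq_nonneg (Real.sqrt x - Real.sqrt α * a), Real.sq_sqrt hx, Real.sq_sqrt hα]
  · rw [min_eq_right h]
    have h₁ : Real.sqrt p ≤ Real.sqrt α * a := by
      rw [← Real.sqrt_sq ha, ← Real.sqrt_mul hα]
      exact Real.sqrt_le_sqrt h
    have h₂ : Real.sqrt x ≤ Real.sqrt p := Real.sqrt_le_sqrt hxp
    nlinarith [Real.sq_sqrt hx, Real.sq_sqrt hp,
      mul_nonneg (sub_nonneg.2 h₂) (by linarith : 0 ≤ 2 * (Real.sqrt α * a) - √p - √x)]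

theorem sum_mul_sqrt_le_sum_mul_sqrt_min {n : Type*} [Fintype n] {a x p : n → ℝ} {α : ℝ}
    (ha : ∀ i, 0 ≤ a i) (hα : 0 < α) (hx : ∀ i, 0 ≤ x i) (hp : ∀ i, 0 ≤ p i)
    (hxp : ∀ i, x i ≤ p i) (hsum : ∑ i, x i ≤ ∑ i, min (α * a i ^ 2) (p i)) :
    ∑ i, a i * Real.sqrt (x i) ≤ ∑ i, a i * Real.sqrt (min (α * a i ^ 2) (p i)) := by
  have h := Finset.sum_le_sum fun i (_ : i ∈ Finset.univ) =>
    two_mul_sqrt_mul_sub_sqrt_min_le (ha i) hα.le (hx i) (hp i) (hxp i)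
  rw [← Finset.mul_sum, Finset.sum_sub_distrib, Finset.sum_sub_distrib] at h
  have hs : 0 < 2 * Real.sqrt α := by positivity
  exact sub_nonpos.1 (nonpos_of_mul_nonpos_right (h.trans (sub_nonpos.2 hsum)) hs)

theorem star_dotProduct_vecMulVec_mulVec {n : Type*} [Fintype n] (v q : n → ℂ) :
    star v ⬝ᵥ vecMulVec q (star q) *ᵥ v = ((‖star v ⬝ᵥ q‖ ^ 2 : ℝ) : ℂ) := by
  have h : star q ⬝ᵥ v = star (star v ⬝ᵥ q) := star_dotProduct _ _
  rw [vecMulVec_mulVec, h, Complex.ofReal_pow, ← Complex.mul_conj', starRingEnd_apply,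
    dotProduct_smul, op_smul_eq_mul]

/-- Theorem 3 (unit-rank MIMO capacity): for `H = c·u·vᴴ` of rank one with unit-norm
`u, v` and all `vᵢ ≠ 0`, the rank-one matrix `Q* = q qᴴ` built from the water-filling
parameter `α` is feasible, meets the total power constraint with equality, and achieves
the capacity `log(1 + c²(Σᵢ |vᵢ|·√(min(α|vᵢ|², Pᵢ)))²)`. -/
theorem stmt_9 (nR nT : ℕ) (u : Fin nR → ℂ) (v : Fin nT → ℂ)
    (hu : ∑ i, ‖u i‖ ^ 2 = 1) (hv : ∑ i, ‖v i‖ ^ 2 = 1) (hvi : ∀ i, v i ≠ 0)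
    (c : ℝ) (hc : 0 < c)
    (P : Fin nT → ℝ) (hP : ∀ i, 0 < P i) (Ptot : ℝ) (hPtot : 0 < Ptot)
    (hsum : Ptot ≤ ∑ i, P i)
    (α : ℝ) (hα : 0 < α) (hαeq : ∑ i, min (α * ‖v i‖ ^ 2) (P i) = Ptot) :
    Feasible P Ptot
      (Matrix.vecMulVec
        (fun i => (Real.sqrt (min (α * ‖v i‖ ^ 2) (P i)) : ℂ) * (v i / (‖v i‖ : ℂ)))
        (star fun i => (Real.sqrt (min (α * ‖v i‖ ^ 2) (P i)) : ℂ) * (v i / (‖v i‖ : ℂ)))) ∧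
    (Matrix.vecMulVec
        (fun i => (Real.sqrt (min (α * ‖v i‖ ^ 2) (P i)) : ℂ) * (v i / (‖v i‖ : ℂ)))
        (star fun i => (Real.sqrt (min (α * ‖v i‖ ^ 2) (P i)) : ℂ) * (v i / (‖v i‖ : ℂ)))).trace.re
      = Ptot ∧
    (∀ Q, Feasible P Ptot Q →
      mutualInfo ((c : ℂ) • Matrix.vecMulVec u (star v)) Q ≤
        mutualInfo ((c : ℂ) • Matrix.vecMulVec u (star v))
          (Matrix.vecMulVec
            (fun i => (Real.sqrt (min (α * ‖v i‖ ^ 2) (P i)) : ℂ) * (v i / (‖v i‖ : ℂ)))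
            (star fun i =>
              (Real.sqrt (min (α * ‖v i‖ ^ 2) (P i)) : ℂ) * (v i / (‖v i‖ : ℂ))))) ∧
    mutualInfo ((c : ℂ) • Matrix.vecMulVec u (star v))
        (Matrix.vecMulVec
          (fun i => (Real.sqrt (min (α * ‖v i‖ ^ 2) (P i)) : ℂ) * (v i / (‖v i‖ : ℂ)))
          (star fun i => (Real.sqrt (min (α * ‖v i‖ ^ 2) (P i)) : ℂ) * (v i / (‖v i‖ : ℂ)))) =
      Real.log (1 + c ^ 2 * (∑ i, ‖v i‖ * Real.sqrt (min (α * ‖v i‖ ^ 2) (P i))) ^ 2) := by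
  set m : Fin nT → ℝ := fun i => min (α * ‖v i‖ ^ 2) (P i) with hm
  set q : Fin nT → ℂ := fun i => (Real.sqrt (min (α * ‖v i‖ ^ 2) (P i)) : ℂ) *
    (v i / (‖v i‖ : ℂ)) with hq
  have hm0 (i : Fin nT) : 0 ≤ m i := le_min (by positivity) (hP i).le
  have hv0 (i : Fin nT) : (‖v i‖ : ℂ) ≠ 0 := by simpa using hvi i
  have hdiag (i : Fin nT) : vecMulVec q (star q) i i = (m i : ℂ) := by
    have hn : ‖q i‖ = Real.sqrt (m i) := by
      simp [hq, hm, hvi i, abs_of_nonneg (Real.sqrt_nonneg _)]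
    rw [vecMulVec_apply, Pi.star_apply, ← starRingEnd_apply, Complex.mul_conj', hn,
      ← Complex.ofReal_pow, Real.sq_sqrt (hm0 i)]
  have htr : (vecMulVec q (star q)).trace.re = Ptot := by
    simp [trace, hdiag, ← hαeq, hm]
  have hvq : star v ⬝ᵥ q = ((∑ i, ‖v i‖ * Real.sqrt (m i) : ℝ) : ℂ) := by
    rw [dotProduct, Complex.ofReal_sum]
    refine Finset.sum_congr rfl fun i _ => ?_
    have h := Complex.conj_mul' (v i)
    simp only [hq, Pi.star_apply, ← starRingEnd_apply, Complex.ofReal_mul]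
    field_simp [hv0 i]
    linear_combination (Real.sqrt (m i) : ℂ) * h
  have hval : (star v ⬝ᵥ vecMulVec q (star q) *ᵥ v).re =
      (∑ i, ‖v i‖ * Real.sqrt (m i)) ^ 2 := by
    rw [star_dotProduct_vecMulVec_mulVec, hvq, Complex.ofReal_re, Complex.norm_real,
      Real.norm_eq_abs, sq_abs]
  refine ⟨⟨posSemidef_vecMulVec_self_star q, fun i => ?_, htr.le⟩, htr, ?_, ?_⟩
  · rw [hdiag, Complex.ofReal_re]
    exact min_le_right _ _
  · rintro Q ⟨hQ, hQP, hQt⟩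
    have hQd (i : Fin nT) : 0 ≤ (Q i i).re := (Complex.le_def.1 hQ.diag_nonneg).1
    have hle : ∑ i, ‖v i‖ * Real.sqrt (Q i i).re ≤ ∑ i, ‖v i‖ * Real.sqrt (m i) := by
      refine sum_mul_sqrt_le_sum_mul_sqrt_min (fun i => norm_nonneg _) hα hQd
        (fun i => (hP i).le) hQP ?_
      rw [hαeq]
      simpa [trace] using hQt
    have hQv : 0 ≤ (star v ⬝ᵥ Q *ᵥ v).re := hQ.re_dotProduct_nonneg v
    rw [mutualInfo_smul_vecMulVec u v hu, mutualInfo_smul_vecMulVec u v hu, hval]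
    refine Real.log_le_log (by positivity) ?_
    gcongr
    refine (hQ.re_dotProduct_mulVec_le v).trans ?_
    gcongr
  · rw [mutualInfo_smul_vecMulVec u v hu, hval]
end

section
/- (Correctness of Algorithm 1.) Let v ∈ ℂ^{n_T} with v_i ≠ 0 for every i, let P_1,…,P_{n_T} > 0 and 0 < P_tot ≤ Σ_{i=1}^{n_T} P_i. Set ρ_i = P_i/|v_i|² and let π be a permutation of {1,…,n_T} with ρ_{π(1)} ≤ ρ_{π(2)} ≤ … ≤ ρ_{π(n_T)}. For 1 ≤ i ≤ n_T define α_i = (P_tot − Σ_{k=1}^{i−1} P_{π(k)}) / (Σ_{k=i}^{n_T} |v_{π(k)}|²). Then there exists an index i with α_i ≤ ρ_{π(i)}, and for the least such index i* the value α = α_{i*} satisfies Σ_{i=1}^{n_T} min(α|v_i|², P_i) = P_tot. -/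
open Finset in
/-- At the largest index the candidate water level lies below the threshold ratio. -/
lemma exists_waterLevel_le {n : ℕ} (w p : Fin n → ℝ) (hw : ∀ k, 0 < w k) (T : ℝ) (hT : 0 < T)
    (hsum : T ≤ ∑ k, p k) :
    ∃ i : Fin n, (T - ∑ k ∈ univ.filter (fun k => k < i), p k) /
      (∑ k ∈ univ.filter (fun k => i ≤ k), w k) ≤ p i / w i := by
  cases n with
  | zero => simp at hsum; linarith
  | succ m =>
    refine ⟨Fin.last m, ?_⟩
    have hge : univ.filter (fun k => Fin.last m ≤ k) = {Fin.last m} := by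
      ext k; simp [Fin.last_le_iff]
    have hsplit := sum_filter_add_sum_filter_not univ (fun k => k < Fin.last m) p
    simp only [not_lt, hge, sum_singleton] at hsplit
    rw [hge, sum_singleton]
    have := hw (Fin.last m)
    gcongr
    linarith

open Finset in
/-- If the ratio at `j` is below the candidate water level at `j`, it is also below the candidate
water level at the successor `i` of `j`. -/
lemma ratio_lt_waterLevel_of_covBy {n : ℕ} (w p : Fin n → ℝ) (hw : ∀ k, 0 < w k) (T : ℝ)
    {i j : Fin n} (hji : j ⋖ i)
    (hj : p j / w j < (T - ∑ k ∈ univ.filter (fun k => k < j), p k) /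
      (∑ k ∈ univ.filter (fun k => j ≤ k), w k)) :
    p j / w j < (T - ∑ k ∈ univ.filter (fun k => k < i), p k) /
      (∑ k ∈ univ.filter (fun k => i ≤ k), w k) := by
  have hpos : ∀ l : Fin n, 0 < ∑ k ∈ univ.filter (fun k => l ≤ k), w k := fun l =>
    sum_pos (fun k _ => hw k) ⟨l, by simp⟩
  have hlt : univ.filter (fun k => k < i) = insert j (univ.filter (fun k => k < j)) := by
    ext k; simp [hji.lt_iff_le_left, le_iff_eq_or_lt]
  have hge : univ.filter (fun k => j ≤ k) = insert j (univ.filter (fun k => i ≤ k)) := by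
    ext k; simp [← hji.lt_iff_le_right, le_iff_eq_or_lt, eq_comm]
  rw [lt_div_iff₀ (hpos j), hge, sum_insert (by simpa using hji.lt), mul_add,
    div_mul_cancel₀ _ (hw j).ne'] at hj
  rw [lt_div_iff₀ (hpos i), hlt, sum_insert (by simp)]
  linarith

open Finset in
/-- The candidate water level at the least index where it is at most the threshold ratio
distributes exactly the total `T`. -/
lemma sum_min_waterLevel {n : ℕ} (w p : Fin n → ℝ) (hw : ∀ k, 0 < w k) (T : ℝ)
    (hmono : Monotone fun k => p k / w k) (i : Fin n)
    (hi : (T - ∑ k ∈ univ.filter (fun k => k < i), p k) /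
      (∑ k ∈ univ.filter (fun k => i ≤ k), w k) ≤ p i / w i)
    (hlt : ∀ j < i, p j / w j < (T - ∑ k ∈ univ.filter (fun k => k < j), p k) /
      (∑ k ∈ univ.filter (fun k => j ≤ k), w k)) :
    ∑ l, min ((T - ∑ k ∈ univ.filter (fun k => k < i), p k) /
      (∑ k ∈ univ.filter (fun k => i ≤ k), w k) * w l) (p l) = T := by
  have hpos : 0 < ∑ k ∈ univ.filter (fun k => i ≤ k), w k :=
    sum_pos (fun k _ => hw k) ⟨i, by simp⟩
  have hbelow : ∀ k < i, p k / w k ≤ (T - ∑ k ∈ univ.filter (fun k => k < i), p k) /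
      (∑ k ∈ univ.filter (fun k => i ≤ k), w k) := fun k hk => by
    obtain ⟨j, hkj, hji⟩ := exists_le_covBy_of_lt hk
    exact (hmono hkj).trans (ratio_lt_waterLevel_of_covBy w p hw T hji (hlt j hji.lt)).le
  set α := (T - ∑ k ∈ univ.filter (fun k => k < i), p k) /
    (∑ k ∈ univ.filter (fun k => i ≤ k), w k) with hα
  rw [← sum_filter_add_sum_filter_not univ (fun k => k < i)]
  simp only [not_lt]
  have hfull : ∑ k ∈ univ.filter (fun k => k < i), min (α * w k) (p k) =
      ∑ k ∈ univ.filter (fun k => k < i), p k := sum_congr rfl fun k hk =>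
    min_eq_right ((div_le_iff₀ (hw k)).1 (hbelow k (by simpa using hk)))
  have hpartial : ∑ k ∈ univ.filter (fun k => i ≤ k), min (α * w k) (p k) =
      ∑ k ∈ univ.filter (fun k => i ≤ k), α * w k := sum_congr rfl fun k hk =>
    min_eq_left ((le_div_iff₀ (hw k)).1 (hi.trans (hmono (by simpa using hk))))
  rw [hfull, hpartial, ← mul_sum, hα, div_mul_cancel₀ _ hpos.ne']
  ring


/-- Correctness of Algorithm 1: with `ρᵢ = Pᵢ/|vᵢ|²` sorted increasingly by the
permutation `π` and `αᵢ = (Ptot − Σ_{k<i} P_{π(k)}) / (Σ_{k≥i} |v_{π(k)}|²)`, there is an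
index `i` with `αᵢ ≤ ρ_{π(i)}`, and for the least such index the returned value `α = αᵢ`
solves `Σᵢ min(α|vᵢ|², Pᵢ) = Ptot`. -/
theorem stmt_11 (nT : ℕ) (v : Fin nT → ℂ) (hv : ∀ i, v i ≠ 0)
    (P : Fin nT → ℝ) (hP : ∀ i, 0 < P i) (Ptot : ℝ) (hPtot : 0 < Ptot)
    (hsum : Ptot ≤ ∑ i, P i)
    (π : Equiv.Perm (Fin nT))
    (hsort : Monotone fun i => P (π i) / ‖v (π i)‖ ^ 2) :
    (∃ i : Fin nT,
      (Ptot - ∑ k ∈ Finset.univ.filter (fun k => k < i), P (π k)) /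
          (∑ k ∈ Finset.univ.filter (fun k => i ≤ k), ‖v (π k)‖ ^ 2) ≤
        P (π i) / ‖v (π i)‖ ^ 2) ∧
    ∀ i : Fin nT,
      (Ptot - ∑ k ∈ Finset.univ.filter (fun k => k < i), P (π k)) /
          (∑ k ∈ Finset.univ.filter (fun k => i ≤ k), ‖v (π k)‖ ^ 2) ≤
        P (π i) / ‖v (π i)‖ ^ 2 →
      (∀ j : Fin nT, j < i →
        P (π j) / ‖v (π j)‖ ^ 2 <
          (Ptot - ∑ k ∈ Finset.univ.filter (fun k => k < j), P (π k)) /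
            (∑ k ∈ Finset.univ.filter (fun k => j ≤ k), ‖v (π k)‖ ^ 2)) →
      ∑ l, min
          ((Ptot - ∑ k ∈ Finset.univ.filter (fun k => k < i), P (π k)) /
              (∑ k ∈ Finset.univ.filter (fun k => i ≤ k), ‖v (π k)‖ ^ 2) * ‖v l‖ ^ 2)
          (P l) = Ptot := by
  have hw : ∀ k, 0 < ‖v (π k)‖ ^ 2 := fun k => pow_pos (norm_pos_iff.2 (hv _)) 2
  refine ⟨exists_waterLevel_le (fun k => ‖v (π k)‖ ^ 2) (fun k => P (π k)) hw Ptot hPtot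
    (by rwa [Equiv.sum_comp π P]), fun i hi hlt => ?_⟩
  rw [← Equiv.sum_comp π]
  exact sum_min_waterLevel (fun k => ‖v (π k)‖ ^ 2) (fun k => P (π k)) hw Ptot hsort i hi hlt
end

section
/- (Sufficiency of the KKT conditions.) Let H be an n_R×n_T complex matrix, let P_1,…,P_{n_T} ≥ 0 and P_tot ≥ 0, and let Q* be feasible. Suppose there exist a real λ ≥ 0, an n_T×n_T real diagonal matrix Λ with nonnegative diagonal entries, and an n_T×n_T Hermitian positive semidefinite matrix M such that Hᴴ(I_{n_R} + H Q* Hᴴ)⁻¹H = λ·I_{n_T} + Λ − M, M·Q* = 0, Λ_{ii}·((Q*)_{ii} − P_i) = 0 for every i, and λ·(trace(Q*) − P_tot) = 0. Then Q* maximizes the mutual information I(Q) = log det(I_{n_R} + H Q Hᴴ) over all feasible Q. -/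
open Matrix
open scoped ComplexOrder

open scoped MatrixOrder in
/-- A positive semidefinite complex matrix has a Gram factorization. -/
lemma Matrix.PosSemidef.exists_eq_conjTranspose_mul_self_s13 {n : Type*} [Fintype n] [DecidableEq n]
    {A : Matrix n n ℂ} (hA : A.PosSemidef) : ∃ Y : Matrix n n ℂ, A = Yᴴ * Y :=
  CStarAlgebra.nonneg_iff_eq_star_mul_self.mp hA.nonneg

/-- The trace of a product of positive semidefinite matrices is nonnegative. -/
lemma Matrix.PosSemidef.trace_mul_nonneg_s13 {n : Type*} [Fintype n] [DecidableEq n]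
    {A B : Matrix n n ℂ} (hA : A.PosSemidef) (hB : B.PosSemidef) : 0 ≤ (A * B).trace := by
  obtain ⟨Y, rfl⟩ := hA.exists_eq_conjTranspose_mul_self_s13
  rw [Matrix.mul_assoc, Matrix.trace_mul_comm]
  exact (hB.mul_mul_conjTranspose_same Y).trace_nonneg

/-- `log det C ≤ tr C - n` for positive definite `C`. -/
lemma Matrix.PosDef.log_det_re_le {n : Type*} [Fintype n] [DecidableEq n]
    {C : Matrix n n ℂ} (hC : C.PosDef) :
    Real.log C.det.re ≤ C.trace.re - Fintype.card n := by
  have hdet : C.det.re = ∏ i, hC.1.eigenvalues i := by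
    rw [hC.1.det_eq_prod_eigenvalues]
    norm_cast
  have htr : C.trace.re = ∑ i, hC.1.eigenvalues i := by
    rw [hC.1.trace_eq_sum_eigenvalues]
    norm_cast
  rw [hdet, htr, Real.log_prod fun i _ => (hC.eigenvalues_pos i).ne']
  calc ∑ i, Real.log (hC.1.eigenvalues i) ≤ ∑ i, (hC.1.eigenvalues i - 1) :=
        Finset.sum_le_sum fun i _ => Real.log_le_sub_one_of_pos (hC.eigenvalues_pos i)
    _ = _ := by simp

/-- The tangent-line bound expressing concavity of `log det` at `A`. -/
lemma Matrix.PosDef.log_det_re_le_add_trace {n : Type*} [Fintype n] [DecidableEq n]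
    {A B : Matrix n n ℂ} (hA : A.PosDef) (hB : B.PosDef) :
    Real.log B.det.re ≤ Real.log A.det.re + (A⁻¹ * (B - A)).trace.re := by
  obtain ⟨Y, hY⟩ := hA.inv.posSemidef.exists_eq_conjTranspose_mul_self_s13
  have hAu : IsUnit A.det := (Matrix.isUnit_iff_isUnit_det A).mp hA.isUnit
  have hdetY : Yᴴ.det * Y.det = A.det⁻¹ := by
    rw [← Matrix.det_mul, ← hY, Matrix.det_nonsing_inv, Ring.inverse_eq_inv']
  have hdet : (Y * B * Yᴴ).det = A.det⁻¹ * B.det := by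
    rw [Matrix.det_mul, Matrix.det_mul, ← hdetY]
    ring
  have htr : (Y * B * Yᴴ).trace = (A⁻¹ * B).trace := by
    rw [Matrix.trace_mul_comm, hY, ← Matrix.mul_assoc]
  have hC : (Y * B * Yᴴ).PosDef := by
    rw [(hB.posSemidef.mul_mul_conjTranspose_same Y).posDef_iff_det_ne_zero, hdet]
    exact mul_ne_zero (inv_ne_zero hA.det_pos.ne') hB.det_pos.ne'
  obtain ⟨hApos, hAim⟩ := Complex.pos_iff.mp hA.det_pos
  obtain ⟨hBpos, -⟩ := Complex.pos_iff.mp hB.det_pos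
  have hAre : A.det = (A.det.re : ℂ) := Complex.ext rfl (by simp [← hAim])
  have hre : (Y * B * Yᴴ).det.re = A.det.re⁻¹ * B.det.re := by
    rw [hdet, hAre, ← Complex.ofReal_inv, Complex.re_ofReal_mul, Complex.ofReal_re]
  have hlog := hC.log_det_re_le
  rw [hre, htr, Real.log_mul (inv_ne_zero hApos.ne') hBpos.ne', Real.log_inv] at hlog
  rw [Matrix.mul_sub, Matrix.nonsing_inv_mul A hAu, Matrix.trace_sub, Matrix.trace_one,
    Complex.sub_re, Complex.natCast_re]
  linarith

/-- `I + H Q Hᴴ` is positive definite for positive semidefinite `Q`. -/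
lemma Matrix.PosSemidef.one_add_mul_mul_conjTranspose_posDef {m n : Type*} [Fintype m] [Fintype n]
    [DecidableEq m] (H : Matrix m n ℂ) {Q : Matrix n n ℂ} (hQ : Q.PosSemidef) :
    (1 + H * Q * Hᴴ).PosDef :=
  Matrix.PosDef.one.add_posSemidef (hQ.mul_mul_conjTranspose_same H)

/-- Sufficiency of the KKT conditions: a feasible `Q*` admitting multipliers `λ ≥ 0`,
diagonal `Λ ≥ 0` and Hermitian PSD `M` satisfying stationarity and complementary
slackness maximizes the mutual information over the feasible set. -/
theorem stmt_13 (nR nT : ℕ) (H : Matrix (Fin nR) (Fin nT) ℂ)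
    (P : Fin nT → ℝ) (hP : ∀ i, 0 ≤ P i) (Ptot : ℝ) (hPtot : 0 ≤ Ptot)
    (Qopt : Matrix (Fin nT) (Fin nT) ℂ) (hfeas : Feasible P Ptot Qopt)
    (lam : ℝ) (hlam : 0 ≤ lam) (L : Fin nT → ℝ) (hL : ∀ i, 0 ≤ L i)
    (M : Matrix (Fin nT) (Fin nT) ℂ) (hM : M.PosSemidef)
    (hstat : Hᴴ * (1 + H * Qopt * Hᴴ)⁻¹ * H =
      (lam : ℂ) • (1 : Matrix (Fin nT) (Fin nT) ℂ) +
        Matrix.diagonal (fun i => (L i : ℂ)) - M)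
    (hMQ : M * Qopt = 0)
    (hcsL : ∀ i, L i * ((Qopt i i).re - P i) = 0)
    (hcslam : lam * (Qopt.trace.re - Ptot) = 0) :
    ∀ Q, Feasible P Ptot Q → mutualInfo H Q ≤ mutualInfo H Qopt := by
  intro Q hQ
  have hbound := (hfeas.1.one_add_mul_mul_conjTranspose_posDef H).log_det_re_le_add_trace
    (hQ.1.one_add_mul_mul_conjTranspose_posDef H)
  have hcycle : ((1 + H * Qopt * Hᴴ)⁻¹ * (1 + H * Q * Hᴴ - (1 + H * Qopt * Hᴴ))).trace =
      (Hᴴ * (1 + H * Qopt * Hᴴ)⁻¹ * H * (Q - Qopt)).trace := by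
    rw [add_sub_add_left_eq_sub, ← Matrix.sub_mul, ← Matrix.mul_sub, ← Matrix.mul_assoc,
      Matrix.trace_mul_comm]
    simp only [Matrix.mul_assoc]
  have hdiag : (Matrix.diagonal (fun i => (L i : ℂ)) * (Q - Qopt)).trace.re =
      ∑ i, L i * ((Q i i).re - (Qopt i i).re) := by
    simp [Matrix.trace, Matrix.diagonal_mul]
  have htrace : (Hᴴ * (1 + H * Qopt * Hᴴ)⁻¹ * H * (Q - Qopt)).trace.re =
      lam * (Q.trace.re - Qopt.trace.re) + ∑ i, L i * ((Q i i).re - (Qopt i i).re)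
        - (M * Q).trace.re := by
    rw [hstat, Matrix.sub_mul, Matrix.add_mul, Matrix.trace_sub, Matrix.trace_add,
      Complex.sub_re, Complex.add_re, hdiag, Matrix.mul_sub M, hMQ, sub_zero]
    simp
  have hpower : lam * (Q.trace.re - Qopt.trace.re) ≤ 0 := by
    nlinarith [mul_le_mul_of_nonneg_left hQ.2.2 hlam]
  have hantenna : ∑ i, L i * ((Q i i).re - (Qopt i i).re) ≤ 0 :=
    Finset.sum_nonpos fun i _ => by
      nlinarith [mul_le_mul_of_nonneg_left (hQ.2.1 i) (hL i), hcsL i]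
  have hMnonneg := (Complex.nonneg_iff.mp (hM.trace_mul_nonneg_s13 hQ.1)).1
  unfold mutualInfo
  rw [hcycle, htrace] at hbound
  linarith
end

section
/- Let F and R be n×n complex Hermitian matrices with R positive semidefinite and F·R = R + R². Then there exist a unitary matrix U and real diagonal matrices Λ_F and Λ_R such that F = U Λ_F Uᴴ, R = U Λ_R Uᴴ, and for every index i either (Λ_R)_{ii} = 0 or (Λ_R)_{ii} = (Λ_F)_{ii} − 1 > 0. Consequently (F − I_n)₊ − R is positive semidefinite. -/
open Matrix
open scoped ComplexOrder

theorem Matrix.eq_mul_diagonal_mul_conjTranspose_of_mulVec {n : Type*} [Fintype n] [DecidableEq n]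
    {U A : Matrix n n ℂ} (hU : U ∈ unitaryGroup n ℂ) (d : n → ℂ)
    (h : ∀ j, A *ᵥ U.col j = d j • U.col j) : A = U * diagonal d * Uᴴ := by
  have hAU : A * U = U * diagonal d := by
    ext i j
    have := congrFun (h j) i
    rw [mul_diagonal, mul_comm]
    exact this
  rw [← hAU, Matrix.mul_assoc, ← star_eq_conjTranspose, mem_unitaryGroup_iff.1 hU,
    Matrix.mul_one]

/-- A matrix intertwining two diagonal matrices also intertwines their images under any
function. -/
theorem Matrix.diagonal_comp_mul_eq_mul_diagonal_comp {n : Type*} [Fintype n] [DecidableEq n]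
    {W : Matrix n n ℂ} {a b : n → ℝ} (f : ℝ → ℝ)
    (h : diagonal (fun i => (a i : ℂ)) * W = W * diagonal (fun i => (b i : ℂ))) :
    diagonal (fun i => (f (a i) : ℂ)) * W = W * diagonal (fun i => (f (b i) : ℂ)) := by
  ext i j
  have hij := congrFun (congrFun h i) j
  rw [diagonal_mul, mul_diagonal, mul_comm] at hij ⊢
  rcases eq_or_ne (W i j) 0 with h0 | h0
  · simp [h0]
  · rw [Complex.ofReal_injective (mul_left_cancel₀ h0 hij)]

theorem posPartMat_eq_of_eq_unitary_conj {n : ℕ} {U A : Matrix (Fin n) (Fin n) ℂ}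
    (hU : U ∈ unitaryGroup (Fin n) ℂ) (d : Fin n → ℝ)
    (hA : A = U * diagonal (fun i => (d i : ℂ)) * Uᴴ) :
    posPartMat A = U * diagonal (fun i => ((max (d i) 0 : ℝ) : ℂ)) * Uᴴ := by
  have hherm : A.IsHermitian := by
    rw [hA]
    exact isHermitian_mul_mul_conjTranspose U
      (isHermitian_diagonal_of_self_adjoint _ (by ext i; simp))
  rw [posPartMat, dif_pos hherm]
  have hspec : A = hherm.eigenvectorUnitary *
      diagonal (fun i => (hherm.eigenvalues i : ℂ)) *
        star (hherm.eigenvectorUnitary : Matrix (Fin n) (Fin n) ℂ) := by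
    simpa [Function.comp_def, Unitary.conjStarAlgAut_apply] using hherm.spectral_theorem
  generalize hherm.eigenvalues = μ at *
  generalize hherm.eigenvectorUnitary = W at *
  obtain ⟨V, hV⟩ := W
  simp only at hspec ⊢
  have hV₁ : star V * V = 1 := mem_unitaryGroup_iff'.1 hV
  have hV₂ : V * star V = 1 := mem_unitaryGroup_iff.1 hV
  have hU₁ : star U * U = 1 := mem_unitaryGroup_iff'.1 hU
  have hU₂ : U * star U = 1 := mem_unitaryGroup_iff.1 hU
  rw [← star_eq_conjTranspose] at hA ⊢
  have hinter : diagonal (fun i => (μ i : ℂ)) * (star V * U) =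
      (star V * U) * diagonal (fun i => (d i : ℂ)) := by
    calc _ = (star V * V) * diagonal (fun i => (μ i : ℂ)) * (star V * U) := by
          rw [hV₁, Matrix.one_mul]
      _ = star V * (V * diagonal (fun i => (μ i : ℂ)) * star V) * U := by
          simp only [Matrix.mul_assoc]
      _ = star V * (U * diagonal (fun i => (d i : ℂ)) * star U) * U := by rw [← hspec, hA]
      _ = star V * U * diagonal (fun i => (d i : ℂ)) * (star U * U) := by
          simp only [Matrix.mul_assoc]
      _ = _ := by rw [hU₁, Matrix.mul_one]
  have hmax := diagonal_comp_mul_eq_mul_diagonal_comp (fun x => max x 0) hinter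
  calc _ = V * diagonal (fun i => ((max (μ i) 0 : ℝ) : ℂ)) * star V * (U * star U) := by
        rw [hU₂, Matrix.mul_one]
    _ = V * (diagonal (fun i => ((max (μ i) 0 : ℝ) : ℂ)) * (star V * U)) * star U := by
        simp only [Matrix.mul_assoc]
    _ = (V * star V) * U * diagonal (fun i => ((max (d i) 0 : ℝ) : ℂ)) * star U := by
        rw [hmax]; simp only [Matrix.mul_assoc]
    _ = _ := by rw [hV₂, Matrix.one_mul]

theorem Matrix.mem_spectrum_real_of_mulVec_eq {n : Type*} [Fintype n] [DecidableEq n]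
    {A : Matrix n n ℂ} {v : n → ℂ} {r : ℝ} (hv : v ≠ 0) (h : A *ᵥ v = (r : ℂ) • v) :
    r ∈ spectrum ℝ A := by
  rw [spectrum.mem_iff]
  intro hunit
  apply hv
  apply mulVec_injective_of_isUnit hunit
  rw [sub_mulVec, h, mulVec_zero, sub_eq_zero, Algebra.algebraMap_eq_smul_one, smul_mulVec,
    one_mulVec]
  exact (Complex.coe_smul r v).symm

/-- Two Hermitian matrices whose product vanishes are simultaneously diagonalizable by the
eigenvectors of a generic real combination of them. -/
theorem Matrix.IsHermitian.exists_unitary_diagonal_of_mul_eq_zero {n : Type*} [Fintype n]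
    [DecidableEq n] {G R : Matrix n n ℂ} (hG : G.IsHermitian) (hR : R.IsHermitian)
    (hGR : G * R = 0) :
    ∃ U ∈ unitaryGroup n ℂ, ∃ g r : n → ℝ,
      G = U * diagonal (fun i => (g i : ℂ)) * Uᴴ ∧
      R = U * diagonal (fun i => (r i : ℂ)) * Uᴴ ∧ ∀ i, g i = 0 ∨ r i = 0 := by
  have hRG : R * G = 0 := by
    rw [← conjTranspose_eq_zero, conjTranspose_mul, hG.eq, hR.eq, hGR]
  have hfin : (insert 0 (Set.image2 (fun g r : ℝ => g / r)
      (spectrum ℝ G) (spectrum ℝ R))).Finite := by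
    refine Set.Finite.insert _ (Set.Finite.image2 _ ?_ ?_)
    · rw [hG.spectrum_real_eq_range_eigenvalues]; exact Set.finite_range _
    · rw [hR.spectrum_real_eq_range_eigenvalues]; exact Set.finite_range _
  obtain ⟨t, ht⟩ := hfin.infinite_compl.nonempty
  simp only [Set.mem_compl_iff, Set.mem_insert_iff, not_or] at ht
  obtain ⟨ht0, ht⟩ := ht
  have htc : (t : ℂ) ≠ 0 := by exact_mod_cast ht0
  have hM : (G + t • R).IsHermitian :=
    hG.add (by rw [IsHermitian, conjTranspose_smul, hR.eq, star_trivial])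
  have key : ∀ (v : n → ℂ) (m : ℝ), (G + t • R) *ᵥ v = (m : ℂ) • v →
      ∃ g r : ℝ, G *ᵥ v = (g : ℂ) • v ∧ R *ᵥ v = (r : ℂ) • v ∧ (g = 0 ∨ r = 0) := by
    intro v m hv
    have hv' : G *ᵥ v + (t : ℂ) • (R *ᵥ v) = (m : ℂ) • v := by
      rw [← hv, add_mulVec, smul_mulVec, Complex.coe_smul]
    have hRR : R *ᵥ (R *ᵥ v) = ((m / t : ℝ) : ℂ) • (R *ᵥ v) := by
      have := congrArg (R *ᵥ ·) hv'
      simp only [mulVec_add, mulVec_smul, mulVec_mulVec, hRG, zero_mulVec, zero_add] at this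
      rw [mulVec_mulVec, Complex.ofReal_div, div_eq_inv_mul, mul_smul, ← this,
        inv_smul_smul₀ htc]
    have hGG : G *ᵥ (G *ᵥ v) = (m : ℂ) • (G *ᵥ v) := by
      have := congrArg (G *ᵥ ·) hv'
      simpa only [mulVec_add, mulVec_smul, mulVec_mulVec, hGR, zero_mulVec, smul_zero,
        add_zero] using this
    by_cases hRv : R *ᵥ v = 0
    · exact ⟨m, 0, by simpa [hRv] using hv', by simp [hRv], Or.inr rfl⟩
    by_cases hGv : G *ᵥ v = 0
    · refine ⟨0, m / t, by simp [hGv], ?_, Or.inl rfl⟩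
      rw [hGv, zero_add] at hv'
      rw [Complex.ofReal_div, div_eq_inv_mul, mul_smul, ← hv', inv_smul_smul₀ htc]
    exfalso
    rcases eq_or_ne m 0 with rfl | hm
    · apply hRv
      rw [zero_div, Complex.ofReal_zero, zero_smul] at hRR
      have hstar : star (R *ᵥ v) ⬝ᵥ (R *ᵥ v) = 0 := by
        rw [star_mulVec, hR.eq, ← dotProduct_mulVec, hRR, dotProduct_zero]
      exact dotProduct_star_self_eq_zero.1 hstar
    · exact ht ⟨m, mem_spectrum_real_of_mulVec_eq hGv hGG, m / t,
        mem_spectrum_real_of_mulVec_eq hRv hRR, by field_simp⟩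
  choose g r hg hr hgr using fun j => key _ _ (hM.mulVec_eigenvectorBasis j)
  exact ⟨hM.eigenvectorUnitary, hM.eigenvectorUnitary.2, g, r,
    eq_mul_diagonal_mul_conjTranspose_of_mulVec hM.eigenvectorUnitary.2 _ hg,
    eq_mul_diagonal_mul_conjTranspose_of_mulVec hM.eigenvectorUnitary.2 _ hr, hgr⟩

/-- Hermitian `F` and PSD `R` with `F·R = R + R²` are simultaneously unitarily
diagonalizable, with each eigenvalue of `R` either `0` or `λ_F − 1 > 0`; consequently
`(F − I)₊ − R` is positive semidefinite. -/
theorem stmt_16 (n : ℕ) (F R : Matrix (Fin n) (Fin n) ℂ)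
    (hF : F.IsHermitian) (hR : R.PosSemidef) (h : F * R = R + R ^ 2) :
    (∃ U : Matrix (Fin n) (Fin n) ℂ, U ∈ Matrix.unitaryGroup (Fin n) ℂ ∧
      ∃ ΛF ΛR : Fin n → ℝ,
        F = U * Matrix.diagonal (fun i => (ΛF i : ℂ)) * Uᴴ ∧
        R = U * Matrix.diagonal (fun i => (ΛR i : ℂ)) * Uᴴ ∧
        ∀ i, ΛR i = 0 ∨ (ΛR i = ΛF i - 1 ∧ 0 < ΛR i)) ∧
    (posPartMat (F - 1) - R).PosSemidef := by
  have hG : (F - 1 - R).IsHermitian := (hF.sub isHermitian_one).sub hR.isHermitian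
  have hGR : (F - 1 - R) * R = 0 := by
    rw [sub_mul, sub_mul, h, one_mul, sq]
    abel
  obtain ⟨U, hU, g, r, hGU, hRU, hgr⟩ :=
    hG.exists_unitary_diagonal_of_mul_eq_zero hR.isHermitian hGR
  have hU₁ : Uᴴ * U = 1 := mem_unitaryGroup_iff'.1 hU
  have hU₂ : U * Uᴴ = 1 := mem_unitaryGroup_iff.1 hU
  have hr : ∀ i, 0 ≤ r i := by
    have hdiag : Uᴴ * R * U = diagonal (fun i => (r i : ℂ)) := by
      rw [hRU, show Uᴴ * (U * diagonal (fun i => (r i : ℂ)) * Uᴴ) * U =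
        (Uᴴ * U) * diagonal (fun i => (r i : ℂ)) * (Uᴴ * U) by simp only [Matrix.mul_assoc],
        hU₁, Matrix.one_mul, Matrix.mul_one]
    have hpsd := hR.conjTranspose_mul_mul_same U
    rw [hdiag, posSemidef_diagonal_iff] at hpsd
    exact fun i => by exact_mod_cast hpsd i
  have hF1 : F - 1 = U * diagonal (fun i => ((g i + r i : ℝ) : ℂ)) * Uᴴ := by
    calc F - 1 = (F - 1 - R) + R := by abel
      _ = U * (diagonal (fun i => (g i : ℂ)) + diagonal (fun i => (r i : ℂ))) * Uᴴ := by
        rw [Matrix.mul_add, Matrix.add_mul, ← hGU, ← hRU]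
      _ = _ := by simp only [diagonal_add, Complex.ofReal_add]
  refine ⟨⟨U, hU, fun i => g i + r i + 1, r, ?_, hRU, fun i => ?_⟩, ?_⟩
  · calc F = (F - 1) + U * 1 * Uᴴ := by rw [Matrix.mul_one, hU₂]; abel
      _ = U * (diagonal (fun i => ((g i + r i : ℝ) : ℂ)) + 1) * Uᴴ := by
        rw [Matrix.mul_add, Matrix.add_mul, ← hF1]
      _ = _ := by simp only [← diagonal_one, diagonal_add, Complex.ofReal_add, Complex.ofReal_one]
  · rcases (hr i).eq_or_lt with h0 | h0
    · exact Or.inl h0.symm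
    · refine Or.inr ⟨?_, h0⟩
      simp [(hgr i).resolve_right h0.ne']
  · rw [posPartMat_eq_of_eq_unitary_conj hU _ hF1]
    have hsub : U * diagonal (fun i => ((max (g i + r i) 0 : ℝ) : ℂ)) * Uᴴ - R =
        U * diagonal (fun i => ((max (g i + r i) 0 - r i : ℝ) : ℂ)) * Uᴴ := by
      conv_lhs => rw [hRU]
      rw [← Matrix.sub_mul, ← Matrix.mul_sub, diagonal_sub]
      simp only [Complex.ofReal_sub]
    rw [hsub]
    refine PosSemidef.mul_mul_conjTranspose_same (posSemidef_diagonal_iff.2 fun i => ?_) U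
    have : 0 ≤ max (g i + r i) 0 - r i := by
      rcases hgr i with h0 | h0 <;> simp [h0]
    exact_mod_cast this
end

section
/- Let K be an n×n Hermitian positive definite complex matrix, let Ď be an n×n real diagonal matrix with strictly positive diagonal entries, and let Q = K⁻¹(K Ď K − I_n)₊ K⁻¹. If trace(Q) ≤ P_tot, then trace(Ď) ≤ P_tot + trace(K⁻²). -/
open Matrix
open scoped ComplexOrder

/-- The positive part of a Hermitian matrix dominates it in the Loewner order. -/
lemma posPartMat_sub_self_posSemidef {n : ℕ} {A : Matrix (Fin n) (Fin n) ℂ}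
    (hA : A.IsHermitian) : (posPartMat A - A).PosSemidef := by
  set U : Matrix (Fin n) (Fin n) ℂ := (hA.eigenvectorUnitary : Matrix (Fin n) (Fin n) ℂ)
    with hU
  have hspec : A = U * diagonal (fun i => (hA.eigenvalues i : ℂ)) * star U := by
    conv_lhs => rw [hA.spectral_theorem]
    rw [Unitary.conjStarAlgAut_apply]
    rfl
  have hdiff : posPartMat A - A =
      U * diagonal (fun i => ((max (hA.eigenvalues i) 0 - hA.eigenvalues i : ℝ) : ℂ)) *
        Uᴴ := by
    conv_lhs => rw [posPartMat, dif_pos hA, ← hU]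
    conv_lhs => arg 2; rw [hspec]
    rw [← sub_mul, ← mul_sub, diagonal_sub, star_eq_conjTranspose]
    simp only [Complex.ofReal_sub]
  rw [hdiff]
  refine PosSemidef.mul_mul_conjTranspose_same (posSemidef_diagonal_iff.mpr fun i => ?_) U
  exact Complex.zero_le_real.mpr (sub_nonneg.mpr (le_max_left _ _))

/-- Trace bound used to initialize the optimization: if `Q = K⁻¹(K Ď K − I)₊ K⁻¹` has
trace at most `Ptot`, then `tr(Ď) ≤ Ptot + tr(K⁻²)`. -/
theorem stmt_18 (n : ℕ) (K : Matrix (Fin n) (Fin n) ℂ) (hK : K.PosDef)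
    (d : Fin n → ℝ) (hd : ∀ i, 0 < d i) (Ptot : ℝ)
    (htr : (K⁻¹ * posPartMat (K * Matrix.diagonal (fun i => (d i : ℂ)) * K - 1) *
      K⁻¹).trace.re ≤ Ptot) :
    ∑ i, d i ≤ Ptot + (K⁻¹ * K⁻¹).trace.re := by
  have hdet : IsUnit K.det := (isUnit_iff_isUnit_det K).mp hK.isUnit
  set D : Matrix (Fin n) (Fin n) ℂ := diagonal (fun i => (d i : ℂ)) with hD
  have hDH : D.IsHermitian := isHermitian_diagonal_of_self_adjoint _ (by
    ext i
    simp)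
  have hA : (K * D * K - 1).IsHermitian := by
    refine IsHermitian.sub ?_ isHermitian_one
    simpa only [hK.isHermitian.eq] using isHermitian_mul_mul_conjTranspose K hDH
  have hnonneg := ((posPartMat_sub_self_posSemidef hA).mul_mul_conjTranspose_same
    K⁻¹).trace_nonneg
  have hconj : K⁻¹ * (K * D * K - 1) * K⁻¹ = D - K⁻¹ * K⁻¹ := by
    rw [mul_sub, sub_mul, mul_one, mul_assoc K D K, nonsing_inv_mul_cancel_left _ _ hdet,
      mul_nonsing_inv_cancel_right _ _ hdet]
  rw [hK.isHermitian.inv.eq, mul_sub, sub_mul, hconj, trace_sub, trace_sub] at hnonneg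
  have hre := (Complex.le_def.mp hnonneg).1
  have htrD : D.trace.re = ∑ i, d i := by simp [hD, trace_diagonal]
  simp only [Complex.sub_re, Complex.zero_re, htrD] at hre
  linarith
end
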